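/- arXiv:2211.14722 — 10 statements merged into one kernel-verified Lean document; each statement's English description precedes it below -/
import Mathlib

section
/- Suppose that every subsequence (α(t_p))_p of (α(t))_t along which M_i(t_p) → ∞ as p → ∞ for every i has a further convergent subsequence whose limit satisfies the OCBA optimality conditions. Then lim_{t→∞} [ (α_b(t)/σ_b)² − ∑_{i≠b} (α_i(t)/σ_i)² ] = 0, and for all i, j ≠ b, lim_{t→∞} [ (μ_b−μ_i)²/(σ_i²/α_i(t) + σ_b²/α_b(t)) − (μ_b−μ_j)²/(σ_j²/α_j(t) + σ_b²/α_b(t)) ] = 0. -/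
open Filter Topology

/-- A counter that goes up whenever the unbounded sequence `N` increases tends to infinity. -/
theorem tendsto_increment_counter {N M : ℕ → ℕ} (hN : Tendsto N atTop atTop)
    (hM : ∀ t, M (t + 1) = M t + (if N t < N (t + 1) then 1 else 0)) :
    Tendsto M atTop atTop := by
  have hmono : Monotone M := monotone_nat_of_le_succ fun t => by rw [hM]; omega
  have hstep : ∀ t s, t ≤ s → M t < M s ∨ N s ≤ N t := by
    intro t s hts
    induction s, hts using Nat.le_induction with
    | base => exact Or.inr le_rfl
    | succ s hts ih =>
      have hMs := hM s
      have := hmono hts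
      split_ifs at hMs <;> omega
  refine tendsto_atTop_atTop_of_monotone hmono fun n => ?_
  induction n with
  | zero => exact ⟨0, Nat.zero_le _⟩
  | succ n ih =>
    obtain ⟨t, ht⟩ := ih
    obtain ⟨s, hs, hts⟩ := ((hN.eventually_gt_atTop (N t)).and (eventually_ge_atTop t)).exists
    exact ⟨s, by have := hstep t s hts; omega⟩

/-- If every strictly increasing index sequence has a refinement along which `f` tends to `l`,
then `f` tends to `l`. -/
theorem tendsto_of_strictMono_subseq_tendsto {X : Type*} {f : ℕ → X} {l : Filter X}
    (h : ∀ φ : ℕ → ℕ, StrictMono φ →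
      ∃ ψ : ℕ → ℕ, Tendsto (fun q => f (φ (ψ q))) atTop l) :
    Tendsto f atTop l := by
  refine tendsto_of_subseq_tendsto fun ns hns => ?_
  obtain ⟨χ, -, hχ⟩ := strictMono_subseq_of_tendsto_atTop hns
  obtain ⟨ψ, hψ⟩ := h _ hχ
  exact ⟨χ ∘ ψ, hψ⟩

/-- With `k ≥ 2` designs, unique best design `b` (`μ b > μ i` for `i ≠ b`)
and standard deviations `σ i > 0`, suppose every subsequence of the allocation fractions
along which `M i (t p) → ∞` for every `i` has a further convergent subsequence whose limit
`α` (with `α i > 0`, `∑ α i = 1`) satisfies the OCBA optimality conditions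
`(α b / σ b)² = ∑_{i ≠ b} (α i / σ i)²` and
`(μ b − μ i)²/(σ i²/α i + σ b²/α b) = (μ b − μ j)²/(σ j²/α j + σ b²/α b)` for all `i, j ≠ b`.
Then the corresponding expressions evaluated along the allocation fractions tend to `0`. -/
theorem stmt1
    (k : ℕ) (hk : 2 ≤ k)
    (μ σ : Fin k → ℝ) (b : Fin k)
    (hb : ∀ i, i ≠ b → μ i < μ b)
    (hσ : ∀ i, 0 < σ i)
    (N : Fin k → ℕ → ℕ)
    (hNpos : ∀ i t, 0 < N i t)
    (hNinf : ∀ i, Tendsto (fun t => N i t) atTop atTop)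
    (M : Fin k → ℕ → ℕ)
    (hM0 : ∀ i, M i 0 = 0)
    (hM : ∀ i t, M i (t + 1) = M i t + (if N i t < N i (t + 1) then 1 else 0))
    (alloc : Fin k → ℕ → ℝ)
    (halloc : ∀ i t, alloc i t = (N i t : ℝ) / (∑ j, (N j t : ℝ)))
    (hsub : ∀ φ : ℕ → ℕ, StrictMono φ →
      (∀ i, Tendsto (fun p => M i (φ p)) atTop atTop) →
      ∃ ψ : ℕ → ℕ, StrictMono ψ ∧ ∃ α : Fin k → ℝ,
        (∀ i, Tendsto (fun q => alloc i (φ (ψ q))) atTop (𝓝 (α i))) ∧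
        (∀ i, 0 < α i) ∧ (∑ i, α i = 1) ∧
        (α b / σ b) ^ 2 = ∑ i ∈ Finset.univ.erase b, (α i / σ i) ^ 2 ∧
        (∀ i ∈ Finset.univ.erase b, ∀ j ∈ Finset.univ.erase b,
          (μ b - μ i) ^ 2 / (σ i ^ 2 / α i + σ b ^ 2 / α b)
            = (μ b - μ j) ^ 2 / (σ j ^ 2 / α j + σ b ^ 2 / α b))) :
    Tendsto (fun t =>
        (alloc b t / σ b) ^ 2 - ∑ i ∈ Finset.univ.erase b, (alloc i t / σ i) ^ 2)
      atTop (𝓝 0) ∧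
    ∀ i ∈ Finset.univ.erase b, ∀ j ∈ Finset.univ.erase b,
      Tendsto (fun t =>
          (μ b - μ i) ^ 2 / (σ i ^ 2 / alloc i t + σ b ^ 2 / alloc b t)
            - (μ b - μ j) ^ 2 / (σ j ^ 2 / alloc j t + σ b ^ 2 / alloc b t))
        atTop (𝓝 0) := by
  have hMinf : ∀ φ : ℕ → ℕ, StrictMono φ → ∀ i, Tendsto (fun p => M i (φ p)) atTop atTop :=
    fun φ hφ i => (tendsto_increment_counter (hNinf i) (hM i)).comp hφ.tendsto_atTop
  constructor
  · refine tendsto_of_strictMono_subseq_tendsto fun φ hφ => ?_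
    obtain ⟨ψ, -, α, hα, -, -, hbal, -⟩ := hsub φ hφ (hMinf φ hφ)
    refine ⟨ψ, ?_⟩
    rw [← sub_eq_zero.mpr hbal]
    exact (((hα b).div_const _).pow 2).sub
      (tendsto_finsetSum _ fun i _ => ((hα i).div_const _).pow 2)
  · intro i hi j hj
    refine tendsto_of_strictMono_subseq_tendsto fun φ hφ => ?_
    obtain ⟨ψ, -, α, hα, hpos, -, -, hrate⟩ := hsub φ hφ (hMinf φ hφ)
    refine ⟨ψ, ?_⟩
    rw [← sub_eq_zero.mpr (hrate i hi j hj)]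
    have hlim : ∀ m, Tendsto (fun q => (μ b - μ m) ^ 2 /
        (σ m ^ 2 / alloc m (φ (ψ q)) + σ b ^ 2 / alloc b (φ (ψ q)))) atTop
        (𝓝 ((μ b - μ m) ^ 2 / (σ m ^ 2 / α m + σ b ^ 2 / α b))) := fun m => by
      have hne : σ m ^ 2 / α m + σ b ^ 2 / α b ≠ 0 :=
        (add_pos (div_pos (pow_pos (hσ m) 2) (hpos m))
          (div_pos (pow_pos (hσ b) 2) (hpos b))).ne'
      exact tendsto_const_nhds.div ((tendsto_const_nhds.div (hα m) (hpos m).ne').add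
        (tendsto_const_nhds.div (hα b) (hpos b).ne')) hne
    exact (hlim i).sub (hlim j)
end

section
/- For every t ≥ 1 and all real numbers r > 0 and v ≥ 0, P( −S_t ≥ r and K_t ≤ v ) ≤ exp( −r² / (2v + 2r/3) ). -/
open Filter Topology MeasureTheory ProbabilityTheory

theorem three_sub_mul_exp_le (y : ℝ) :
    (3 - y) * Real.exp y ≤ 3 + 2 * y + y ^ 2 / 2 := by
  have hd1 : ∀ x : ℝ, HasDerivAt (fun x : ℝ => 2 + x - (2 - x) * Real.exp x)
      (1 - (1 - x) * Real.exp x) x := fun x => by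
    refine (((hasDerivAt_id x).const_add 2).sub
      (((hasDerivAt_id x).const_sub 2).mul (Real.hasDerivAt_exp x))).congr_deriv ?_
    simp only [id]
    ring
  have hd0 : ∀ x : ℝ, HasDerivAt (fun x : ℝ => 3 + 2 * x + x ^ 2 / 2 - (3 - x) * Real.exp x)
      (2 + x - (2 - x) * Real.exp x) x := fun x => by
    refine (((((hasDerivAt_id x).const_mul 2).const_add 3).add
      (((hasDerivAt_id x).pow 2).div_const 2)).sub
      (((hasDerivAt_id x).const_sub 3).mul (Real.hasDerivAt_exp x))).congr_deriv ?_
    simp only [id, Nat.cast_ofNat]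
    ring
  have hmono : Monotone (fun x : ℝ => 2 + x - (2 - x) * Real.exp x) := by
    refine monotone_of_hasDerivAt_nonneg hd1 fun x => ?_
    have h := mul_le_mul_of_nonneg_right (Real.add_one_le_exp (-x)) (Real.exp_pos x).le
    rw [← Real.exp_add, neg_add_cancel, Real.exp_zero] at h
    simp only [Pi.zero_apply]
    linarith
  have hcont : Continuous (fun x : ℝ => 3 + 2 * x + x ^ 2 / 2 - (3 - x) * Real.exp x) := by
    fun_prop
  rcases le_total 0 y with hy | hy
  · have hm := monotoneOn_of_hasDerivWithinAt_nonneg (convex_Ici (0 : ℝ)) hcont.continuousOn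
      (fun x _ => (hd0 x).hasDerivWithinAt) fun x hx => by
        rw [interior_Ici] at hx
        have := hmono (Set.mem_Ioi.1 hx).le
        simpa using this
    have := hm (Set.mem_Ici.2 le_rfl) (Set.mem_Ici.2 hy) hy
    simp at this
    linarith
  · have hm := antitoneOn_of_hasDerivWithinAt_nonpos (convex_Iic (0 : ℝ)) hcont.continuousOn
      (fun x _ => (hd0 x).hasDerivWithinAt) fun x hx => by
        rw [interior_Iic] at hx
        have := hmono (Set.mem_Iio.1 hx).le
        simpa using this
    have := hm (Set.mem_Iic.2 hy) (Set.mem_Iic.2 le_rfl) hy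
    simp at this
    linarith

/-- The quadratic bound on the exponential behind Bernstein's inequality. -/
theorem exp_mul_le_one_add_quadratic {l x : ℝ} (hl0 : 0 < l) (hl3 : l < 3) (hx : x ≤ 1) :
    Real.exp (l * x) ≤ 1 + l * x + l ^ 2 / (2 * (1 - l / 3)) * x ^ 2 := by
  have hlx : l * x ≤ l := by nlinarith
  have h3 : 0 < 3 - l * x := by linarith
  have h3' : 0 < 3 - l := by linarith
  have h := three_sub_mul_exp_le (l * x)
  have h1 : Real.exp (l * x) ≤ 1 + l * x + 3 * (l * x) ^ 2 / (2 * (3 - l * x)) := by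
    rw [← mul_le_mul_iff_right₀ h3]
    refine h.trans (le_of_eq ?_)
    field_simp
    ring
  have h2 : 3 * (l * x) ^ 2 / (2 * (3 - l * x)) ≤ 3 * (l * x) ^ 2 / (2 * (3 - l)) := by
    gcongr
  have h4 : l ^ 2 / (2 * (1 - l / 3)) * x ^ 2 = 3 * (l * x) ^ 2 / (2 * (3 - l)) := by
    have : 1 - l / 3 ≠ 0 := by intro h; linarith
    field_simp
  linarith

/-- One step of the exponential supermartingale in Freedman's inequality. -/
theorem integral_mul_exp_sub_condExp_sq_le {Ω : Type*} {m m₀ : MeasurableSpace Ω}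
    {P : Measure Ω} [IsProbabilityMeasure P] (hm : m ≤ m₀) {l g : ℝ} (hg : 0 ≤ g)
    (hexp : ∀ x ≤ (1 : ℝ), Real.exp (l * x) ≤ 1 + l * x + g * x ^ 2)
    {W X : Ω → ℝ} (hW : StronglyMeasurable[m] W) (hW0 : ∀ ω, 0 ≤ W ω)
    {C : ℝ} (hWC : ∀ᵐ ω ∂P, W ω ≤ C)
    (hX : Measurable X) (hX1 : ∀ᵐ ω ∂P, |X ω| ≤ 1) (hX0 : P[X | m] =ᵐ[P] 0) :
    ∫ ω, W ω * Real.exp (l * X ω - g * (P[fun ω' => X ω' ^ 2 | m]) ω) ∂P ≤ ∫ ω, W ω ∂P := by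
  set q : Ω → ℝ := P[fun ω' => X ω' ^ 2 | m] with hq
  have hqm : StronglyMeasurable[m] q := stronglyMeasurable_condExp
  have hq0 : 0 ≤ᵐ[P] q := condExp_nonneg (ae_of_all _ fun ω => sq_nonneg (X ω))
  have hWi : Integrable W P :=
    Integrable.of_bound (hW.mono hm).aestronglyMeasurable C <| by
      filter_upwards [hWC] with ω h
      rwa [Real.norm_eq_abs, abs_of_nonneg (hW0 ω)]
  have hXi : Integrable X P := Integrable.of_bound hX.aestronglyMeasurable 1 hX1
  have hX2i : Integrable (fun ω => X ω ^ 2) P :=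
    Integrable.of_bound (hX.pow_const 2).aestronglyMeasurable 1 <| by
      filter_upwards [hX1] with ω h
      rw [Real.norm_eq_abs, abs_pow]
      exact pow_le_one₀ (abs_nonneg _) h
  let U : Ω → ℝ := fun ω => W ω * Real.exp (-(g * q ω))
  have hUm : StronglyMeasurable[m] U :=
    hW.mul (Real.continuous_exp.comp_stronglyMeasurable (hqm.const_mul g).neg)
  have hU0 : ∀ ω, 0 ≤ U ω := fun ω => mul_nonneg (hW0 ω) (Real.exp_pos _).le
  have hUC : ∀ᵐ ω ∂P, ‖U ω‖ ≤ C := by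
    filter_upwards [hWC, hq0] with ω h h0
    rw [Real.norm_eq_abs, abs_of_nonneg (hU0 ω)]
    refine le_trans (mul_le_of_le_one_right (hW0 ω) ?_) h
    exact Real.exp_le_one_iff.2 (neg_nonpos.2 (mul_nonneg hg h0))
  let Y : Ω → ℝ := (fun _ => 1) + (l • X + g • fun ω => X ω ^ 2)
  have hYi : Integrable Y P := (integrable_const 1).add ((hXi.smul l).add (hX2i.smul g))
  have hUYi : Integrable (U * Y) P := hYi.bdd_mul (hUm.mono hm).aestronglyMeasurable hUC
  have hY : P[Y | m] =ᵐ[P] fun ω => 1 + g * q ω := by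
    filter_upwards [condExp_add (integrable_const (1 : ℝ)) ((hXi.smul l).add (hX2i.smul g)) m,
      condExp_add (hXi.smul l) (hX2i.smul g) m, condExp_smul (μ := P) l X m,
      condExp_smul (μ := P) g (fun ω => X ω ^ 2) m, hX0] with ω h1 h2 h3 h4 h5
    simp only [Pi.add_apply, Pi.smul_apply, smul_eq_mul, Pi.zero_apply] at h1 h2 h3 h4 h5
    rw [h1, h2, h3, h4, h5, condExp_const hm]
    ring
  calc ∫ ω, W ω * Real.exp (l * X ω - g * q ω) ∂P
      ≤ ∫ ω, (U * Y) ω ∂P := by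
        refine integral_mono_of_nonneg
          (ae_of_all _ fun ω => mul_nonneg (hW0 ω) (Real.exp_pos _).le) hUYi ?_
        filter_upwards [hX1] with ω h
        have := mul_le_mul_of_nonneg_left (hexp (X ω) (abs_le.1 h).2) (hU0 ω)
        simp only [U, Y, Pi.mul_apply, Pi.add_apply, Pi.smul_apply, smul_eq_mul] at this ⊢
        rw [sub_eq_neg_add, Real.exp_add, ← mul_assoc, ← add_assoc]
        exact this
    _ = ∫ ω, (P[U * Y | m]) ω ∂P := (integral_condExp hm).symm
    _ ≤ ∫ ω, W ω ∂P := by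
        have hpull := condExp_mul_of_stronglyMeasurable_left hUm hUYi hYi
        refine integral_mono_ae integrable_condExp hWi ?_
        filter_upwards [hpull, hY] with ω h1 h2
        rw [h1, Pi.mul_apply, h2]
        have := mul_le_mul_of_nonneg_left (Real.add_one_le_exp (g * q ω)) (hU0 ω)
        simp only [U] at this ⊢
        rw [mul_assoc, mul_assoc, ← Real.exp_add, neg_add_cancel, Real.exp_zero, mul_one,
          ← mul_assoc, add_comm (g * q ω)] at this
        exact this

/-- The exponential supermartingale of Freedman's inequality is integrable, with expectation at
most one. -/
theorem integrable_and_integral_exp_sum_sub_condExp_sq_le_one {Ω : Type*} {m₀ : MeasurableSpace Ω}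
    {P : Measure Ω} [IsProbabilityMeasure P] (ℱ : Filtration ℕ m₀) {l g : ℝ} (hl : 0 ≤ l)
    (hg : 0 ≤ g) (hexp : ∀ x ≤ (1 : ℝ), Real.exp (l * x) ≤ 1 + l * x + g * x ^ 2)
    {X : ℕ → Ω → ℝ} (hX : ∀ n, StronglyMeasurable[ℱ (n + 1)] (X (n + 1)))
    (hX1 : ∀ n, ∀ᵐ ω ∂P, |X (n + 1) ω| ≤ 1) (hX0 : ∀ n, P[X (n + 1) | ℱ n] =ᵐ[P] 0) (n : ℕ) :
    Integrable (fun ω => Real.exp (∑ s ∈ Finset.Icc 1 n,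
      (l * X s ω - g * (P[fun ω' => X s ω' ^ 2 | ℱ (s - 1)]) ω))) P ∧
    ∫ ω, Real.exp (∑ s ∈ Finset.Icc 1 n,
      (l * X s ω - g * (P[fun ω' => X s ω' ^ 2 | ℱ (s - 1)]) ω)) ∂P ≤ 1 := by
  set Z : ℕ → Ω → ℝ := fun n ω => Real.exp (∑ s ∈ Finset.Icc 1 n,
    (l * X s ω - g * (P[fun ω' => X s ω' ^ 2 | ℱ (s - 1)]) ω)) with hZ
  have hZsucc : ∀ n ω, Z (n + 1) ω = Z n ω *
      Real.exp (l * X (n + 1) ω - g * (P[fun ω' => X (n + 1) ω' ^ 2 | ℱ n]) ω) := fun n ω => by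
    simp only [hZ]
    rw [Finset.sum_Icc_succ_top (by omega), Real.exp_add, Nat.add_sub_cancel]
  have hZ0 : ∀ n ω, 0 ≤ Z n ω := fun n ω => (Real.exp_pos _).le
  have key : StronglyMeasurable[ℱ n] (Z n) ∧ (∀ᵐ ω ∂P, Z n ω ≤ Real.exp l ^ n) ∧
      ∫ ω, Z n ω ∂P ≤ 1 := by
    induction n with
    | zero => simpa [hZ] using stronglyMeasurable_const
    | succ n ih =>
      obtain ⟨hm, hb, hi⟩ := ih
      refine ⟨?_, ?_, ?_⟩
      · rw [show Z (n + 1) = _ from funext (hZsucc n)]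
        exact (hm.mono (ℱ.mono n.le_succ)).mul (Real.continuous_exp.comp_stronglyMeasurable
          (((hX n).const_mul l).sub
            ((stronglyMeasurable_condExp.mono (ℱ.mono n.le_succ)).const_mul g)))
      · have hq : 0 ≤ᵐ[P] P[fun ω' => X (n + 1) ω' ^ 2 | ℱ n] :=
          condExp_nonneg (ae_of_all _ fun ω => sq_nonneg _)
        filter_upwards [hb, hX1 n, hq] with ω h1 h2 h3
        rw [hZsucc, pow_succ]
        refine mul_le_mul h1 (Real.exp_le_exp.2 ?_) (Real.exp_pos _).le (by positivity)
        have h4 := mul_le_mul_of_nonneg_left (abs_le.1 h2).2 hl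
        have h5 := mul_nonneg hg h3
        linarith
      · simp_rw [hZsucc]
        exact (integral_mul_exp_sub_condExp_sq_le (ℱ.le n) hg hexp hm (hZ0 n) hb
          ((hX n).mono (ℱ.le _)).measurable (hX1 n) (hX0 n)).trans hi
  obtain ⟨hm, hb, hi⟩ := key
  refine ⟨Integrable.of_bound (hm.mono (ℱ.le n)).aestronglyMeasurable (Real.exp l ^ n) ?_, hi⟩
  filter_upwards [hb] with ω h
  rwa [Real.norm_eq_abs, abs_of_nonneg (hZ0 n ω)]

/-- Freedman's inequality for martingale differences bounded by one, with `v > 0`. -/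
theorem measureReal_sum_ge_and_sum_condExp_sq_le {Ω : Type*} {m₀ : MeasurableSpace Ω}
    {P : Measure Ω} [IsProbabilityMeasure P] (ℱ : Filtration ℕ m₀)
    {X : ℕ → Ω → ℝ} (hX : ∀ n, StronglyMeasurable[ℱ (n + 1)] (X (n + 1)))
    (hX1 : ∀ n, ∀ᵐ ω ∂P, |X (n + 1) ω| ≤ 1) (hX0 : ∀ n, P[X (n + 1) | ℱ n] =ᵐ[P] 0) (n : ℕ)
    {r v : ℝ} (hr : 0 < r) (hv : 0 < v) :
    P.real {ω | r ≤ ∑ s ∈ Finset.Icc 1 n, X s ω ∧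
      ∑ s ∈ Finset.Icc 1 n, (P[fun ω' => X s ω' ^ 2 | ℱ (s - 1)]) ω ≤ v}
      ≤ Real.exp (-(r ^ 2) / (2 * v + 2 * r / 3)) := by
  set l : ℝ := r / (v + r / 3) with hl
  have hd : 0 < v + r / 3 := by positivity
  have hl0 : 0 < l := by positivity
  have hl3' : 1 - l / 3 = v / (v + r / 3) := by rw [hl]; field_simp; ring
  have hpos : 0 < 1 - l / 3 := by rw [hl3']; positivity
  have hl3 : l < 3 := by linarith
  set g : ℝ := l ^ 2 / (2 * (1 - l / 3)) with hgdef
  have hg : 0 ≤ g := by positivity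
  have hlg : -(r ^ 2) / (2 * v + 2 * r / 3) = -(l * r - g * v) := by
    rw [hgdef, hl3', hl]; field_simp; ring
  obtain ⟨hint, hle⟩ := integrable_and_integral_exp_sum_sub_condExp_sq_le_one ℱ hl0.le hg
    (fun x hx => exp_mul_le_one_add_quadratic hl0 hl3 hx) hX hX1 hX0 n
  have hmarkov := (mul_meas_ge_le_integral_of_nonneg (ae_of_all _ fun ω => (Real.exp_pos _).le)
    hint (Real.exp (l * r - g * v))).trans hle
  rw [hlg, Real.exp_neg, ← one_div, le_div_iff₀' (Real.exp_pos _)]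
  refine le_trans (mul_le_mul_of_nonneg_left (measureReal_mono ?_) (Real.exp_pos _).le) hmarkov
  rintro ω ⟨h1, h2⟩
  rw [Set.mem_ofPred_eq, Finset.sum_sub_distrib, ← Finset.mul_sum, ← Finset.mul_sum]
  gcongr

/-- Freedman-type inequality.  `(L s)` is a `[0,1]`-valued sequence of
random variables, `F s` is the σ-algebra generated by `L 1, …, L s` (with `F 0` trivial),
`V s = E[L s | F (s-1)] − L s`, `S t = ∑_{s=1}^t V s`, and
`K t = ∑_{s=1}^t Var[L s | F (s-1)]`.  Then for `t ≥ 1`, `r > 0` and `v ≥ 0`,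
`P(−S t ≥ r ∧ K t ≤ v) ≤ exp(−r² / (2v + 2r/3))`. -/
theorem stmt3
    {Ω : Type*} [MeasurableSpace Ω] (P : Measure Ω) [IsProbabilityMeasure P]
    (L : ℕ → Ω → ℝ)
    (hLmeas : ∀ s, Measurable (L s))
    (hLbdd : ∀ s, ∀ᵐ ω ∂P, L s ω ∈ Set.Icc (0 : ℝ) 1)
    (F : ℕ → MeasurableSpace Ω)
    (hF : ∀ s, F s = ⨆ i ∈ Finset.Icc 1 s, MeasurableSpace.comap (L i) inferInstance)
    (V S K : ℕ → Ω → ℝ)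
    (hV : ∀ s ω, V s ω = (P[L s | F (s - 1)]) ω - L s ω)
    (hS : ∀ t ω, S t ω = ∑ s ∈ Finset.Icc 1 t, V s ω)
    (hK : ∀ t ω, K t ω =
      ∑ s ∈ Finset.Icc 1 t,
        (P[fun ω' => (L s ω' - (P[L s | F (s - 1)]) ω') ^ 2 | F (s - 1)]) ω)
    (t : ℕ) (ht : 1 ≤ t) (r v : ℝ) (hr : 0 < r) (hv : 0 ≤ v) :
    P {ω | r ≤ -S t ω ∧ K t ω ≤ v}
      ≤ ENNReal.ofReal (Real.exp (-(r ^ 2) / (2 * v + 2 * r / 3))) := by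
  have hcomap : ∀ s, MeasurableSpace.comap (L s) inferInstance ≤ ‹MeasurableSpace Ω› :=
    fun s => (hLmeas s).comap_le
  let ℱ : Filtration ℕ ‹MeasurableSpace Ω› :=
    { seq := F
      mono' := fun a b hab => by
        rw [hF a, hF b]
        exact biSup_mono fun i hi =>
          Finset.mem_Icc.2 ⟨(Finset.mem_Icc.1 hi).1, (Finset.mem_Icc.1 hi).2.trans hab⟩
      le' := fun s => by
        rw [hF s]
        exact iSup₂_le fun i _ => hcomap i }
  have hLF : ∀ n, StronglyMeasurable[ℱ (n + 1)] (L (n + 1)) := fun n => by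
    have h : MeasurableSpace.comap (L (n + 1)) inferInstance ≤ F (n + 1) := by
      rw [hF]
      exact le_iSup₂_of_le (n + 1) (Finset.mem_Icc.2 ⟨by omega, le_rfl⟩) le_rfl
    exact (Measurable.of_comap_le h).stronglyMeasurable
  have hLi : ∀ s, Integrable (L s) P := fun s =>
    Integrable.of_bound (hLmeas s).aestronglyMeasurable 1 <| by
      filter_upwards [hLbdd s] with ω h
      rw [Real.norm_eq_abs, abs_of_nonneg h.1]
      exact h.2
  let X : ℕ → Ω → ℝ := fun s => L s - P[L s | F (s - 1)]
  have hX : ∀ n, StronglyMeasurable[ℱ (n + 1)] (X (n + 1)) := fun n =>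
    (hLF n).sub (stronglyMeasurable_condExp.mono (ℱ.mono n.le_succ))
  have hX1 : ∀ n, ∀ᵐ ω ∂P, |X (n + 1) ω| ≤ 1 := fun n => by
    have h0 : 0 ≤ᵐ[P] P[L (n + 1) | ℱ n] :=
      condExp_nonneg ((hLbdd (n + 1)).mono fun ω h => h.1)
    have h1 : P[L (n + 1) | ℱ n] ≤ᵐ[P] P[fun _ => (1 : ℝ) | ℱ n] :=
      condExp_mono (hLi _) (integrable_const 1) ((hLbdd (n + 1)).mono fun ω h => h.2)
    rw [condExp_const (ℱ.le n)] at h1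
    filter_upwards [h0, h1, hLbdd (n + 1)] with ω h0 h1 h2
    have h3 : X (n + 1) ω = L (n + 1) ω - (P[L (n + 1) | ℱ n]) ω := rfl
    have h4 := h2.1
    have h5 := h2.2
    simp only [Pi.zero_apply] at h0
    rw [h3, abs_le]
    constructor <;> linarith
  have hX0 : ∀ n, P[X (n + 1) | ℱ n] =ᵐ[P] 0 := fun n => by
    have h1 : P[P[L (n + 1) | ℱ n] | ℱ n] = P[L (n + 1) | ℱ n] :=
      condExp_of_stronglyMeasurable (ℱ.le n) stronglyMeasurable_condExp integrable_condExp
    have h2 : P[X (n + 1) | ℱ n] =ᵐ[P] P[L (n + 1) | ℱ n] - P[P[L (n + 1) | ℱ n] | ℱ n] :=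
      condExp_sub (hLi _) integrable_condExp _
    rwa [h1, sub_self] at h2
  have hset : ∀ ω, r ≤ -S t ω → r ≤ ∑ s ∈ Finset.Icc 1 t, X s ω := fun ω h => by
    rw [hS, ← Finset.sum_neg_distrib] at h
    simp only [hV, neg_sub] at h
    exact h
  have hbound : ∀ w, v < w → P.real {ω | r ≤ -S t ω ∧ K t ω ≤ v}
      ≤ Real.exp (-(r ^ 2) / (2 * w + 2 * r / 3)) := fun w hw => by
    refine le_trans (measureReal_mono ?_) (measureReal_sum_ge_and_sum_condExp_sq_le ℱ hX hX1 hX0 t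
      hr (hv.trans_lt hw))
    rintro ω ⟨h1, h2⟩
    refine ⟨hset ω h1, ?_⟩
    rw [hK] at h2
    exact h2.trans hw.le
  have hne : 2 * v + 2 * r / 3 ≠ 0 := by positivity
  have hcont : ContinuousAt (fun w : ℝ => Real.exp (-(r ^ 2) / (2 * w + 2 * r / 3))) v := by
    fun_prop (disch := assumption)
  have hlim : P.real {ω | r ≤ -S t ω ∧ K t ω ≤ v}
      ≤ Real.exp (-(r ^ 2) / (2 * v + 2 * r / 3)) :=
    ge_of_tendsto (hcont.tendsto.mono_left (nhdsWithin_le_nhds (s := Set.Ioi v)))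
      (eventually_mem_nhdsWithin.mono fun w hw => hbound w hw)
  rw [← ofReal_measureReal]
  exact ENNReal.ofReal_le_ofReal hlim
end

section
/- Suppose there exist constants c_1,…,c_k > 0 such that N_i(t)/t → c_i as t → ∞ for every i ∈ {1,…,k}. Then lim_{t→∞} (1/t) · log PFS_t = −(1/2) · min_{i≠b} (μ_b − μ_i)² / (σ_i²/c_i + σ_b²/c_b). -/
open Filter Topology MeasureTheory ProbabilityTheory

open scoped NNReal

/-- Chernoff bound for the negative tail of a Gaussian with positive mean. -/
lemma gaussianReal_real_Iio_zero_le {d : ℝ} (hd : 0 < d) {v : ℝ≥0} (hv : 0 < v) :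
    (gaussianReal d v).real (Set.Iio 0) ≤ Real.exp (-(d ^ 2 / (2 * v))) := by
  have hv' : (0 : ℝ) < v := hv
  have hle : -(d / v) ≤ 0 := by
    have : 0 < d / (v : ℝ) := by positivity
    linarith
  have key := measure_le_le_exp_mul_mgf (μ := gaussianReal d v) (X := id) 0 hle
    (integrable_exp_mul_gaussianReal _)
  rw [mgf_id_gaussianReal] at key
  refine (measureReal_mono (fun x (hx : x < 0) => hx.le)).trans (key.trans_eq ?_)
  simp only [mul_zero, Real.exp_zero, one_mul]
  congr 1
  field_simp
  ring

/-- Lower bound for the negative tail of a Gaussian, from the density on `[-v, 0)`. -/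
lemma le_gaussianReal_real_Iio_zero {d : ℝ} (hd : 0 < d) {v : ℝ≥0} (hv : 0 < v) :
    Real.exp (-(d ^ 2 / (2 * v)) - d - v / 2 + (Real.log v - Real.log (2 * Real.pi)) / 2) ≤
      (gaussianReal d v).real (Set.Iio 0) := by
  have hv' : (0 : ℝ) < v := hv
  have hsub : (gaussianReal d v).real (Set.Ico (-(v : ℝ)) 0) ≤
      (gaussianReal d v).real (Set.Iio 0) := measureReal_mono fun x hx => hx.2
  refine le_trans ?_ hsub
  rw [measureReal_def, gaussianReal_apply_eq_integral d hv.ne', ENNReal.toReal_ofReal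
    (integral_nonneg (gaussianPDFReal_nonneg _ _))]
  have hb : ∀ x ∈ Set.Ico (-(v : ℝ)) 0,
      (√(2 * Real.pi * v))⁻¹ * Real.exp (-(d + v) ^ 2 / (2 * v)) ≤ gaussianPDFReal d v x := by
    intro x hx
    rw [gaussianPDFReal]
    gcongr _ * Real.exp (-?_ / _)
    rw [sq_le_sq, abs_of_neg (by linarith [hx.2]), abs_of_pos (by linarith)]
    linarith [hx.1]
  have key := setIntegral_ge_of_const_le_real measurableSet_Ico (by simp) hb
    (integrable_gaussianPDFReal d v).integrableOn
  refine le_trans (le_of_eq ?_) key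
  have hsqrt : (√(2 * Real.pi * v))⁻¹ =
      Real.exp (-((Real.log (2 * Real.pi) + Real.log v) / 2)) := by
    rw [Real.exp_neg, ← Real.log_mul (by positivity) hv'.ne', ← Real.log_sqrt (by positivity),
      Real.exp_log (by positivity)]
  have hvol : volume.real (Set.Ico (-(v : ℝ)) 0) = Real.exp (Real.log v) := by
    rw [Real.exp_log hv', Real.volume_real_Ico_of_le (by linarith)]
    ring
  rw [hsqrt, hvol, ← Real.exp_add, ← Real.exp_add]
  congr 1
  field_simp
  ring

/-- Large deviation rate of the negative tail of Gaussians whose variance decays like `w / t`. -/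
lemma tendsto_log_gaussianReal_real_Iio_zero {d : ℝ} (hd : 0 < d) {v : ℕ → ℝ≥0}
    (hv : ∀ t, 0 < v t) {w : ℝ} (hw : 0 < w)
    (hvw : Tendsto (fun t : ℕ => (t : ℝ) * v t) atTop (𝓝 w)) :
    Tendsto (fun t : ℕ => (1 / (t : ℝ)) * Real.log ((gaussianReal d (v t)).real (Set.Iio 0)))
      atTop (𝓝 (-(d ^ 2 / (2 * w)))) := by
  have hrate : Tendsto (fun t : ℕ => -(d ^ 2 / (2 * ((t : ℝ) * v t)))) atTop
      (𝓝 (-(d ^ 2 / (2 * w)))) :=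
    ((tendsto_const_nhds (x := d ^ 2)).div (hvw.const_mul 2) (by positivity)).neg
  have hinv : Tendsto (fun t : ℕ => 1 / (t : ℝ)) atTop (𝓝 0) := tendsto_one_div_atTop_nhds_zero_nat
  have hlog : Tendsto (fun t : ℕ => Real.log t / (t : ℝ)) atTop (𝓝 0) :=
    (Real.isLittleO_log_id_atTop.tendsto_div_nhds_zero).comp tendsto_natCast_atTop_atTop
  have hlower : Tendsto (fun t : ℕ => -(d ^ 2 / (2 * ((t : ℝ) * v t))) - d * (1 / (t : ℝ))
      - ((t : ℝ) * v t) / 2 * (1 / (t : ℝ)) * (1 / (t : ℝ))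
      + ((Real.log ((t : ℝ) * v t) - Real.log (2 * Real.pi)) * (1 / (t : ℝ))
        - Real.log t / (t : ℝ)) / 2) atTop (𝓝 (-(d ^ 2 / (2 * w)))) := by
    have := ((hrate.sub (hinv.const_mul d)).sub (((hvw.div_const 2).mul hinv).mul hinv)).add
      (((((hvw.log hw.ne').sub_const (Real.log (2 * Real.pi))).mul hinv).sub hlog).div_const 2)
    simpa using this
  refine tendsto_of_tendsto_of_tendsto_of_le_of_le' hlower hrate ?_ ?_
  · filter_upwards [eventually_gt_atTop 0] with t ht
    have ht' : (0 : ℝ) < t := by exact_mod_cast ht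
    have hvt : (0 : ℝ) < v t := hv t
    have h := Real.log_le_log (Real.exp_pos _) (le_gaussianReal_real_Iio_zero hd (hv t))
    rw [Real.log_exp] at h
    refine le_trans (le_of_eq ?_) (mul_le_mul_of_nonneg_left h (by positivity : 0 ≤ 1 / (t : ℝ)))
    rw [Real.log_mul ht'.ne' hvt.ne']
    field_simp
    ring
  · filter_upwards [eventually_gt_atTop 0] with t ht
    have ht' : (0 : ℝ) < t := by exact_mod_cast ht
    have hvt : (0 : ℝ) < v t := hv t
    have h := Real.log_le_log
      ((Real.exp_pos _).trans_le (le_gaussianReal_real_Iio_zero hd (hv t)))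
      (gaussianReal_real_Iio_zero_le hd (hv t))
    rw [Real.log_exp] at h
    refine (mul_le_mul_of_nonneg_left h (by positivity : 0 ≤ 1 / (t : ℝ))).trans (le_of_eq ?_)
    field_simp

/-- The exponential rate of a quantity squeezed between finitely many positive sequences and
their sum is the smallest of their rates. -/
lemma tendsto_log_of_le_sum {ι : Type*} [Fintype ι] [Nonempty ι] {p : ι → ℕ → ℝ} {q : ℕ → ℝ}
    {a : ι → ℝ} (hp : ∀ i t, 0 < p i t) (hpq : ∀ i t, p i t ≤ q t) (hq : ∀ t, q t ≤ ∑ i, p i t)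
    (ha : ∀ i, Tendsto (fun t : ℕ => (1 / (t : ℝ)) * Real.log (p i t)) atTop (𝓝 (-a i))) :
    Tendsto (fun t : ℕ => (1 / (t : ℝ)) * Real.log (q t)) atTop (𝓝 (-⨅ i, a i)) := by
  obtain ⟨j, hj⟩ := exists_eq_ciInf_of_finite (f := a)
  have hqpos : ∀ t, 0 < q t := fun t => (hp j t).trans_le (hpq j t)
  have hinv : Tendsto (fun t : ℕ => 1 / (t : ℝ)) atTop (𝓝 0) := tendsto_one_div_atTop_nhds_zero_nat
  refine tendsto_order.2 ⟨fun x hx => ?_, fun x hx => ?_⟩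
  · filter_upwards [(ha j).eventually_const_lt (hj ▸ hx)] with t ht
    refine ht.trans_le ?_
    gcongr
    exacts [hp j t, hpq j t]
  · obtain ⟨y, hy, hyx⟩ := exists_between hx
    have hsmall : ∀ᶠ t : ℕ in atTop, ∀ i, (1 / (t : ℝ)) * Real.log (p i t) < y := by
      refine eventually_all.2 fun i => (ha i).eventually_lt_const (lt_of_le_of_lt ?_ hy)
      exact neg_le_neg (ciInf_le (Set.finite_range a).bddBelow i)
    have hlim : Tendsto (fun t : ℕ => 1 / (t : ℝ) * Real.log (Fintype.card ι) + y) atTop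
        (𝓝 y) := by
      simpa using (hinv.mul_const (Real.log (Fintype.card ι))).add_const y
    filter_upwards [hsmall, hlim.eventually_lt_const hyx, eventually_gt_atTop 0] with t ht hlt htpos
    have ht' : (0 : ℝ) < t := by exact_mod_cast htpos
    refine lt_of_le_of_lt ?_ hlt
    have hexp : ∀ i, p i t ≤ Real.exp (t * y) := fun i => by
      rw [← Real.log_le_iff_le_exp (hp i t)]
      have := ht i
      rw [one_div_mul_eq_div, div_lt_iff₀ ht'] at this
      linarith
    have hsum : q t ≤ Fintype.card ι * Real.exp (t * y) :=
      (hq t).trans ((Finset.sum_le_card_nsmul _ _ _ fun i _ => hexp i).trans_eq (by simp))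
    have hlog := Real.log_le_log (hqpos t) hsum
    rw [Real.log_mul (by simp) (Real.exp_ne_zero _), Real.log_exp] at hlog
    refine (mul_le_mul_of_nonneg_left hlog (by positivity : 0 ≤ 1 / (t : ℝ))).trans (le_of_eq ?_)
    field_simp

/-- Comparing two distinct coordinates of a product of Gaussians. -/
lemma pi_gaussianReal_real_lt {ι : Type*} [Fintype ι] (m : ι → ℝ) (v : ι → ℝ≥0) {i j : ι}
    (hij : i ≠ j) :
    (Measure.pi fun l => gaussianReal (m l) (v l)).real {z | z j < z i} =
      (gaussianReal (m j - m i) (v i + v j)).real (Set.Iio 0) := by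
  set P := Measure.pi fun l => gaussianReal (m l) (v l) with hP
  have hmap : ∀ l, P.map (fun z => z l) = gaussianReal (m l) (v l) := fun l =>
    (measurePreserving_eval (fun l => gaussianReal (m l) (v l)) l).map_eq
  have hind : iIndepFun (fun l (z : ι → ℝ) => z l) P :=
    iIndepFun_pi (X := fun _ => id) fun _ => aemeasurable_id
  have hneg : P.map (fun z => -z i) = gaussianReal (-m i) (v i) := by
    rw [← gaussianReal_map_neg, ← hmap i, Measure.map_map (by fun_prop) (by fun_prop)]
    rfl
  have hindep : IndepFun (fun z => -z i) (fun z : ι → ℝ => z j) P :=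
    (hind.indepFun hij).comp measurable_neg measurable_id
  have hsum := gaussianReal_add_gaussianReal_of_indepFun hindep hneg (hmap j)
  rw [show m j - m i = -m i + m j by ring, ← hsum,
    map_measureReal_apply (by fun_prop) measurableSet_Iio]
  congr 1
  ext z
  simp

/-- `k ≥ 2` designs with unique best design `b` and `σ i > 0`.  At stage
`t`, the sample means `Z i (t)` are independent Gaussians with mean `μ i` and variance
`σ i² / N i t` (modelled by the product measure below), and
`PFS t = P(∃ i ≠ b, Z b (t) < Z i (t))`.  If `N i t / t → c i > 0` for every `i`, then
`(1/t) log PFS t → −(1/2) · min_{i ≠ b} (μ b − μ i)² / (σ i²/c i + σ b²/c b)`. -/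
theorem stmt6
    (k : ℕ) (hk : 2 ≤ k)
    (μ σ : Fin k → ℝ) (b : Fin k)
    (hb : ∀ i, i ≠ b → μ i < μ b)
    (hσ : ∀ i, 0 < σ i)
    (N : Fin k → ℕ → ℕ) (hNpos : ∀ i t, 0 < N i t)
    (c : Fin k → ℝ) (hc : ∀ i, 0 < c i)
    (hNc : ∀ i, Tendsto (fun t => (N i t : ℝ) / (t : ℝ)) atTop (𝓝 (c i)))
    (PFS : ℕ → ℝ)
    (hPFS : ∀ t, PFS t =
      ((Measure.pi fun i => gaussianReal (μ i) ((σ i ^ 2 / (N i t : ℝ)).toNNReal))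
        {z | ∃ i, i ≠ b ∧ z b < z i}).toReal) :
    Tendsto (fun t : ℕ => (1 / (t : ℝ)) * Real.log (PFS t)) atTop
      (𝓝 (-(1 / 2) * ⨅ i : {i : Fin k // i ≠ b},
        (μ b - μ i.1) ^ 2 / (σ i.1 ^ 2 / c i.1 + σ b ^ 2 / c b))) := by
  set v : Fin k → ℕ → ℝ≥0 := fun i t => (σ i ^ 2 / (N i t : ℝ)).toNNReal with hv
  have hvcoe : ∀ i t, (v i t : ℝ) = σ i ^ 2 / (N i t : ℝ) := fun i t =>
    Real.coe_toNNReal _ (by positivity)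
  have hvpos : ∀ i t, 0 < v i t := fun i t => by
    have := hσ i
    have : (0 : ℝ) < N i t := by exact_mod_cast hNpos i t
    exact Real.toNNReal_pos.2 (by positivity)
  have hvlim : ∀ i, Tendsto (fun t : ℕ => (t : ℝ) * v i t) atTop (𝓝 (σ i ^ 2 / c i)) := fun i => by
    refine ((tendsto_const_nhds (x := σ i ^ 2)).div (hNc i) (hc i).ne').congr fun t => ?_
    simp only [hvcoe, Pi.div_apply]
    rw [div_div_eq_mul_div, mul_comm, mul_div_assoc]
  have : Nontrivial (Fin k) := Fin.nontrivial_iff_two_le.2 hk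
  obtain ⟨j, hj⟩ := exists_ne b
  have : Nonempty {i : Fin k // i ≠ b} := ⟨⟨j, hj⟩⟩
  have hd : ∀ i : {i : Fin k // i ≠ b}, 0 < μ b - μ i.1 := fun i => sub_pos.2 (hb i.1 i.2)
  have hw : ∀ i : Fin k, 0 < σ i ^ 2 / c i + σ b ^ 2 / c b := fun i => by
    have := hσ i; have := hσ b; have := hc i; have := hc b
    positivity
  have hpair : ∀ (i : {i : Fin k // i ≠ b}) t,
      (Measure.pi fun l => gaussianReal (μ l) (v l t)).real {z | z b < z i.1} =
        (gaussianReal (μ b - μ i.1) (v i.1 t + v b t)).real (Set.Iio 0) := fun i t =>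
    pi_gaussianReal_real_lt μ (fun l => v l t) i.2
  have hrate := tendsto_log_of_le_sum
    (p := fun (i : {i : Fin k // i ≠ b}) t =>
      (gaussianReal (μ b - μ i.1) (v i.1 t + v b t)).real (Set.Iio 0)) (q := PFS)
    (a := fun i => (μ b - μ i.1) ^ 2 / (2 * (σ i.1 ^ 2 / c i.1 + σ b ^ 2 / c b)))
    (fun i t => (Real.exp_pos _).trans_le
      (le_gaussianReal_real_Iio_zero (hd i) (add_pos (hvpos i.1 t) (hvpos b t))))
    (fun i t => by
      rw [← hpair, hPFS t]
      exact measureReal_mono fun z hz => ⟨i.1, i.2, hz⟩)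
    (fun t => by
      simp_rw [← hpair]
      rw [hPFS t]
      refine le_trans (measureReal_mono fun z hz => ?_) (measureReal_iUnion_fintype_le _)
      obtain ⟨i, hi, hz⟩ := hz
      exact Set.mem_iUnion.2 ⟨⟨i, hi⟩, hz⟩)
    (fun i => tendsto_log_gaussianReal_real_Iio_zero (hd i)
      (fun t => add_pos (hvpos i.1 t) (hvpos b t)) (hw i.1)
      (((hvlim i.1).add (hvlim b)).congr fun t => by push_cast; ring))
  convert hrate using 2
  rw [neg_mul, Real.mul_iInf_of_nonneg (by norm_num)]
  congr 2
  ext i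
  have := (hw i.1).ne'
  field_simp
end

section
/- Suppose there exist constants c_1,…,c_k > 0 such that N_i(t)/t → c_i as t → ∞ for every i ∈ {1,…,k}. Then lim_{t→∞} (1/t) · log EOC_t = −(1/2) · min_{i≠b} (μ_b − μ_i)² / (σ_i²/c_i + σ_b²/c_b). -/
open Filter Topology MeasureTheory ProbabilityTheory

lemma map_eval_sub_eval_pi_gaussianReal {ι : Type*} [Fintype ι] (m : ι → ℝ)
    (v : ι → NNReal) {i j : ι} (hij : i ≠ j) :
    (Measure.pi fun l => gaussianReal (m l) (v l)).map (fun z => z i - z j) =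
      gaussianReal (m i - m j) (v i + v j) := by
  set P := Measure.pi fun l => gaussianReal (m l) (v l) with hP
  have hlaw : ∀ l, HasLaw (fun z : ι → ℝ => z l) (gaussianReal (m l) (v l)) P := fun l =>
    ⟨(measurable_pi_apply l).aemeasurable,
      (measurePreserving_eval (fun l => gaussianReal (m l) (v l)) l).map_eq⟩
  have hind : iIndepFun (fun l (z : ι → ℝ) => z l) P :=
    iIndepFun_pi (X := fun _ x => x) fun _ => aemeasurable_id
  have hadd := gaussianReal_add_gaussianReal_of_indepFun
    ((hind.indepFun hij).comp measurable_id measurable_neg)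
    (hlaw i).map_eq (gaussianReal_neg (hlaw j)).map_eq
  simpa [sub_eq_add_neg, Pi.add_def, Function.comp_def] using hadd

lemma gaussianReal_Iic_zero_le {m : ℝ} (hm : 0 ≤ m) {v : NNReal} (hv : v ≠ 0) :
    (gaussianReal m v).real (Set.Iic 0) ≤ Real.exp (-(m ^ 2 / (2 * v))) := by
  have hv' : (0 : ℝ) < v := by positivity
  have h := measure_le_le_exp_mul_mgf (μ := gaussianReal m v) (X := id) (t := -(m / v)) 0
    (by rw [neg_nonpos]; positivity) (integrable_exp_mul_gaussianReal _)
  rw [mgf_id_gaussianReal] at h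
  refine h.trans_eq ?_
  simp only [mul_zero, Real.exp_zero, one_mul]
  congr 1
  field_simp
  ring

lemma le_gaussianReal_Iio_zero {m : ℝ} (hm : 0 ≤ m) {v : NNReal} (hv : v ≠ 0) :
    (√(2 * Real.pi))⁻¹ * Real.exp (-((m + √v) ^ 2 / (2 * v))) ≤
      (gaussianReal m v).real (Set.Iio 0) := by
  have hv' : (0 : ℝ) < v := by positivity
  have hs : 0 < √(v : ℝ) := Real.sqrt_pos.2 hv'
  have hsub : (gaussianReal m v).real (Set.Ico (-√v) 0) ≤ (gaussianReal m v).real (Set.Iio 0) :=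
    measureReal_mono fun x hx => hx.2
  refine le_trans ?_ hsub
  rw [measureReal_def, gaussianReal_apply_eq_integral _ hv, ENNReal.toReal_ofReal
    (integral_nonneg fun x => gaussianPDFReal_nonneg _ _ x)]
  have hconst : ∫ _ in Set.Ico (-√(v : ℝ)) 0,
      (√(2 * Real.pi * v))⁻¹ * Real.exp (-((m + √v) ^ 2 / (2 * v))) =
      (√(2 * Real.pi))⁻¹ * Real.exp (-((m + √v) ^ 2 / (2 * v))) := by
    rw [setIntegral_const, measureReal_def, Real.volume_Ico, zero_sub, neg_neg,
      ENNReal.toReal_ofReal hs.le, Real.sqrt_mul (by positivity), smul_eq_mul]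
    field_simp
  rw [← hconst]
  refine setIntegral_mono_on (integrableOn_const (by simp))
    (integrable_gaussianPDFReal m v).integrableOn measurableSet_Ico fun x hx => ?_
  have hsq : (x - m) ^ 2 ≤ (m + √v) ^ 2 :=
    sq_le_sq' (by linarith [hx.1]) (by linarith [hx.2])
  simp only [gaussianPDFReal_def, neg_div]
  gcongr

lemma measureReal_lt_le_sum_measureReal_isBest {ι : Type*} [Fintype ι] [DecidableEq ι]
    (m : ι → ℝ) (v : ι → NNReal) (hv : ∀ i, v i ≠ 0) (i b : ι) :
    (Measure.pi fun l => gaussianReal (m l) (v l)).real {z | z b < z i} ≤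
      ∑ j ∈ Finset.univ.erase b,
        (Measure.pi fun l => gaussianReal (m l) (v l)).real {z | ∀ l, l ≠ j → z l < z j} := by
  set P := Measure.pi fun l => gaussianReal (m l) (v l) with hP
  have hne : ∀ᵐ z ∂P, ∀ p q, p ≠ q → z p ≠ z q := by
    refine ae_all_iff.2 fun p => ae_all_iff.2 fun q => ?_
    by_cases hpq : p = q
    · simp [hpq]
    have hmeas : Measurable fun z : ι → ℝ => z p - z q := by fun_prop
    have hnull := map_eval_sub_eval_pi_gaussianReal m v hpq
    have hatoms := nullSingletonClass_gaussianReal (μ := m p - m q) (v := v p + v q)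
      (by simp [hv p])
    have h0 : P ((fun z : ι → ℝ => z p - z q) ⁻¹' {0}) = 0 := by
      rw [← Measure.map_apply hmeas (measurableSet_singleton 0), hnull]
      exact measure_singleton 0
    refine (measure_eq_zero_iff_ae_notMem.1 h0).mono fun z hz _ h => hz ?_
    simp [h]
  have hsub : {z : ι → ℝ | z b < z i} ≤ᵐ[P]
      ⋃ j ∈ Finset.univ.erase b, {z : ι → ℝ | ∀ l, l ≠ j → z l < z j} := by
    filter_upwards [hne] with z hz hbi
    obtain ⟨j, -, hj⟩ := Finset.exists_max_image Finset.univ z ⟨b, Finset.mem_univ b⟩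
    have hjb : j ≠ b := by
      rintro rfl
      exact (hj i (Finset.mem_univ i)).not_gt hbi
    refine Set.mem_iUnion₂.2 ⟨j, by simp [hjb], fun l hl => ?_⟩
    exact (hj l (Finset.mem_univ l)).lt_of_ne (hz l j hl)
  refine le_trans ?_ (measureReal_biUnion_finset_le _ _)
  exact ENNReal.toReal_mono (measure_ne_top _ _) (measure_mono_ae hsub)

/-- `k ≥ 2` designs with unique best design `b` and `σ i > 0`.  At stage
`t`, the sample means `Z i (t)` are independent Gaussians with mean `μ i` and variance
`σ i² / N i t` (modelled by the product measure below), and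
`EOC t = ∑_j (μ b − μ j) · P(∀ i ≠ j, Z i (t) < Z j (t))`.  If `N i t / t → c i > 0` for
every `i`, then
`(1/t) log EOC t → −(1/2) · min_{i ≠ b} (μ b − μ i)² / (σ i²/c i + σ b²/c b)`. -/
theorem stmt7
    (k : ℕ) (hk : 2 ≤ k)
    (μ σ : Fin k → ℝ) (b : Fin k)
    (hb : ∀ i, i ≠ b → μ i < μ b)
    (hσ : ∀ i, 0 < σ i)
    (N : Fin k → ℕ → ℕ) (hNpos : ∀ i t, 0 < N i t)
    (c : Fin k → ℝ) (hc : ∀ i, 0 < c i)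
    (hNc : ∀ i, Tendsto (fun t => (N i t : ℝ) / (t : ℝ)) atTop (𝓝 (c i)))
    (EOC : ℕ → ℝ)
    (hEOC : ∀ t, EOC t =
      ∑ j, (μ b - μ j) *
        ((Measure.pi fun i => gaussianReal (μ i) ((σ i ^ 2 / (N i t : ℝ)).toNNReal))
          {z | ∀ i, i ≠ j → z i < z j}).toReal) :
    Tendsto (fun t : ℕ => (1 / (t : ℝ)) * Real.log (EOC t)) atTop
      (𝓝 (-(1 / 2) * ⨅ i : {i : Fin k // i ≠ b},
        (μ b - μ i.1) ^ 2 / (σ i.1 ^ 2 / c i.1 + σ b ^ 2 / c b))) := by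
  classical
  set v : ℕ → Fin k → NNReal := fun t i => (σ i ^ 2 / (N i t : ℝ)).toNNReal with hv
  have hNpos' : ∀ i t, (0 : ℝ) < N i t := fun i t => by exact_mod_cast hNpos i t
  have hvcoe : ∀ t i, (v t i : ℝ) = σ i ^ 2 / (N i t : ℝ) := fun t i =>
    Real.coe_toNNReal _ (by have := hNpos' i t; positivity)
  have hvpos : ∀ t i, (0 : ℝ) < v t i := fun t i => by
    rw [hvcoe]; have := hNpos' i t; have := hσ i; positivity
  have hv0 : ∀ t i, v t i ≠ 0 := fun t i => by
    have := hvpos t i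
    exact_mod_cast this.ne'
  set P : ℕ → Measure (Fin k → ℝ) := fun t => Measure.pi fun i => gaussianReal (μ i) (v t i)
    with hP
  set V : Fin k → ℝ := fun i => σ i ^ 2 / c i + σ b ^ 2 / c b with hV
  have hVpos : ∀ i, 0 < V i := fun i => by
    have := hσ i; have := hσ b; have := hc i; have := hc b
    positivity
  set w : Fin k → ℕ → ℝ := fun i t => v t b + v t i with hw
  have hwpos : ∀ i t, 0 < w i t := fun i t => add_pos (hvpos t b) (hvpos t i)
  have hδ : ∀ i, 0 ≤ μ b - μ i := fun i => by
    rcases eq_or_ne i b with rfl | hi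
    · simp
    · linarith [hb i hi]
  have htR : Tendsto (fun t : ℕ => (t : ℝ)) atTop atTop := tendsto_natCast_atTop_atTop
  have hwt : ∀ i, Tendsto (fun t : ℕ => (t : ℝ) * w i t) atTop (𝓝 (V i)) := fun i => by
    have h1 : ∀ j, Tendsto (fun t : ℕ => σ j ^ 2 / ((N j t : ℝ) / t)) atTop
        (𝓝 (σ j ^ 2 / c j)) := fun j => tendsto_const_nhds.div (hNc j) (hc j).ne'
    refine ((h1 i).add (h1 b)).congr fun t => ?_
    simp only [hw, hvcoe]
    have := (hNpos' i t).ne'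
    have := (hNpos' b t).ne'
    field_simp
    ring
  have hw0 : ∀ i, Tendsto (w i) atTop (𝓝 0) := fun i => by
    have h := (hwt i).mul (tendsto_inv_atTop_zero.comp htR)
    rw [mul_zero] at h
    refine h.congr' ?_
    filter_upwards [eventually_gt_atTop 0] with t ht
    have : (t : ℝ) ≠ 0 := by positivity
    simp only [Function.comp]
    field_simp
  have hEOC' : ∀ t, EOC t = ∑ j ∈ Finset.univ.erase b,
      (μ b - μ j) * (P t).real {z | ∀ i, i ≠ j → z i < z j} := fun t => by
    rw [hEOC t, ← Finset.sum_erase_add _ _ (Finset.mem_univ b)]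
    simp [measureReal_def, hP, hv]
  have hmap : ∀ t i, i ≠ b → ∀ s, MeasurableSet s →
      (P t).real ((fun z => z b - z i) ⁻¹' s) =
        (gaussianReal (μ b - μ i) (v t b + v t i)).real s := fun t i hi s hs => by
    rw [← map_eval_sub_eval_pi_gaussianReal μ (v t) hi.symm,
      map_measureReal_apply (by fun_prop) hs]
  have hsum0 : ∀ t i, v t b + v t i ≠ 0 := fun t i => by simp [hv0 t b]
  -- Chernoff upper bound
  have hupper : ∀ t, EOC t ≤ ∑ j ∈ Finset.univ.erase b,
      (μ b - μ j) * Real.exp (-((μ b - μ j) ^ 2 / (2 * w j t))) := fun t => by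
    rw [hEOC' t]
    refine Finset.sum_le_sum fun j hj => mul_le_mul_of_nonneg_left ?_ (hδ j)
    have hjb := Finset.ne_of_mem_erase hj
    have h := gaussianReal_Iic_zero_le (hδ j) (hsum0 t j)
    rw [← hmap t j hjb _ measurableSet_Iic, NNReal.coe_add] at h
    refine le_trans (measureReal_mono fun z hz => ?_) h
    have := hz b hjb.symm
    simp only [Set.mem_preimage, Set.mem_Iic]
    linarith
  have : Nonempty {i : Fin k // i ≠ b} := by
    have : Nontrivial (Fin k) := Fin.nontrivial_iff_two_le.2 hk
    obtain ⟨i, hi⟩ := exists_ne b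
    exact ⟨⟨i, hi⟩⟩
  set r : {i : Fin k // i ≠ b} → ℝ := fun i => (μ b - μ i.1) ^ 2 / V i.1 with hr
  obtain ⟨i₀, hi₀⟩ := exists_eq_ciInf_of_finite (f := r)
  change Tendsto _ _ (𝓝 (-(1 / 2) * ⨅ i, r i))
  obtain ⟨d, hd0, hd⟩ : ∃ d > 0, ∀ j ∈ Finset.univ.erase b, d ≤ μ b - μ j := by
    obtain ⟨j, hj, hmin⟩ := Finset.exists_min_image (Finset.univ.erase b) (fun j => μ b - μ j)
      ⟨i₀.1, by simp [i₀.2]⟩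
    exact ⟨μ b - μ j, sub_pos.2 (hb j (Finset.ne_of_mem_erase hj)), hmin⟩
  have hlower : ∀ t, d * ((√(2 * Real.pi))⁻¹ *
      Real.exp (-((μ b - μ i₀ + √(w i₀ t)) ^ 2 / (2 * w i₀ t)))) ≤ EOC t := fun t => by
    have h := le_gaussianReal_Iio_zero (hδ i₀) (hsum0 t i₀)
    rw [← hmap t i₀ i₀.2 _ measurableSet_Iio, NNReal.coe_add] at h
    have hset : (fun z : Fin k → ℝ => z b - z i₀) ⁻¹' Set.Iio 0 = {z | z b < z i₀} := by
      ext z; simp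
    rw [hset] at h
    rw [hEOC' t]
    refine (mul_le_mul_of_nonneg_left
      (h.trans (measureReal_lt_le_sum_measureReal_isBest μ (v t) (hv0 t) i₀ b)) hd0.le).trans ?_
    rw [Finset.mul_sum]
    exact Finset.sum_le_sum fun j hj => mul_le_mul_of_nonneg_right (hd j hj) measureReal_nonneg
  have hEOCpos : ∀ t, 0 < EOC t := fun t => lt_of_lt_of_le (by positivity) (hlower t)
  have hlog0 : ∀ C : ℝ, Tendsto (fun t : ℕ => C / (t : ℝ)) atTop (𝓝 0) := fun C =>
    htR.const_div_atTop C
  refine tendsto_order.2 ⟨fun a ha => ?_, fun a ha => ?_⟩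
  · have hlim : Tendsto (fun t : ℕ => Real.log (d * (√(2 * Real.pi))⁻¹) / (t : ℝ) -
        (μ b - μ i₀ + √(w i₀ t)) ^ 2 / (2 * (t * w i₀ t))) atTop
        (𝓝 (0 - (μ b - μ i₀ + √0) ^ 2 / (2 * V i₀))) := by
      refine (hlog0 _).sub (Tendsto.div ?_ ((hwt i₀).const_mul 2) ?_)
      · exact (tendsto_const_nhds.add ((hw0 i₀).sqrt)).pow 2
      · have := hVpos i₀
        positivity
    have heq : (0 - (μ b - μ i₀ + √0) ^ 2 / (2 * V i₀)) = -(1 / 2) * ⨅ i, r i := by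
      rw [← hi₀, Real.sqrt_zero]
      simp only [hr]
      have := (hVpos i₀).ne'
      field_simp
      ring
    rw [heq] at hlim
    filter_upwards [hlim.eventually_const_lt ha, eventually_gt_atTop 0] with t hat ht
    refine hat.trans_le ?_
    have ht' : (0 : ℝ) < t := by exact_mod_cast ht
    have h := Real.log_le_log (by positivity) (hlower t)
    rw [← mul_assoc, Real.log_mul (by positivity) (Real.exp_pos _).ne', Real.log_exp] at h
    have h2 := mul_le_mul_of_nonneg_left h (one_div_pos.2 ht').le
    refine le_of_eq_of_le ?_ h2
    have := (hwpos i₀ t).ne'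
    field_simp
    ring
  · obtain ⟨a', ha', haa'⟩ := exists_between ha
    set D := ∑ j ∈ Finset.univ.erase b, (μ b - μ j) with hD
    have hDpos : 0 < D := Finset.sum_pos (fun j hj => hd0.trans_le (hd j hj))
      ⟨i₀.1, by simp [i₀.2]⟩
    have hexp : ∀ j ∈ Finset.univ.erase b, ∀ᶠ t : ℕ in atTop,
        -((μ b - μ j) ^ 2 / (2 * w j t)) ≤ a' * t := fun j hj => by
      have hlim : Tendsto (fun t : ℕ => -((μ b - μ j) ^ 2 / (2 * (t * w j t)))) atTop
          (𝓝 (-((μ b - μ j) ^ 2 / (2 * V j)))) :=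
        (tendsto_const_nhds.div ((hwt j).const_mul 2) (by have := hVpos j; positivity)).neg
      have hlt : -((μ b - μ j) ^ 2 / (2 * V j)) < a' := by
        refine lt_of_le_of_lt ?_ ha'
        have hle := ciInf_le (Set.finite_range r).bddBelow ⟨j, Finset.ne_of_mem_erase hj⟩
        have hrw : (μ b - μ j) ^ 2 / (2 * V j) = 1 / 2 * ((μ b - μ j) ^ 2 / V j) := by
          have := (hVpos j).ne'
          field_simp
        simp only [hr] at hle ⊢
        rw [hrw]
        linarith
      filter_upwards [hlim.eventually_lt_const hlt, eventually_gt_atTop 0] with t hta ht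
      have ht' : (0 : ℝ) < t := by exact_mod_cast ht
      have h := mul_le_mul_of_nonneg_right hta.le ht'.le
      refine le_of_eq_of_le ?_ h
      have := (hwpos j t).ne'
      field_simp
    have hlim : Tendsto (fun t : ℕ => Real.log D / (t : ℝ) + a') atTop (𝓝 (0 + a')) :=
      (hlog0 _).add_const a'
    rw [zero_add] at hlim
    filter_upwards [(Finset.eventually_all _).2 hexp, hlim.eventually_lt_const haa',
      eventually_gt_atTop 0] with t hle hta ht
    have ht' : (0 : ℝ) < t := by exact_mod_cast ht
    refine lt_of_le_of_lt ?_ hta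
    have hE : EOC t ≤ D * Real.exp (a' * t) := by
      refine (hupper t).trans ?_
      rw [hD, Finset.sum_mul]
      exact Finset.sum_le_sum fun j hj =>
        mul_le_mul_of_nonneg_left (Real.exp_le_exp.2 (hle j hj)) (hδ j)
    have h := Real.log_le_log (hEOCpos t) hE
    rw [Real.log_mul hDpos.ne' (Real.exp_pos _).ne', Real.log_exp] at h
    refine (mul_le_mul_of_nonneg_left h (one_div_pos.2 ht').le).trans_eq ?_
    field_simp
end

section
/- Suppose N_b(t)/t → 1 as t → ∞, and for each i ≠ b there exists c_i > 0 such that N_i(t)/log t → c_i as t → ∞. Then lim_{t→∞} (log EOC_t)/(log t) = −(1/2) · min_{i≠b} (μ_b − μ_i)² c_i / σ_i². -/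
open Filter Topology MeasureTheory ProbabilityTheory

lemma gaussianReal_upper_tail_le (m : ℝ) {s : ℝ} (hs : 0 < s) {n : ℕ} (hn : 0 < n)
    {d : ℝ} (hd : 0 ≤ d) :
    (gaussianReal m (s ^ 2 / (n : ℝ)).toNNReal).real {x | m + d ≤ x} ≤
      Real.exp (-(d ^ 2 / (2 * s ^ 2)) * n) := by
  have hn' : (0 : ℝ) < n := by exact_mod_cast hn
  have h := measure_ge_le_exp_mul_mgf (μ := gaussianReal m (s ^ 2 / (n : ℝ)).toNNReal)
    (X := id) (t := d * n / s ^ 2) (m + d) (by positivity)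
    (integrable_exp_mul_gaussianReal _)
  rw [mgf_id_gaussianReal, ← Real.exp_add, Real.coe_toNNReal _ (by positivity)] at h
  refine h.trans (Real.exp_le_exp.2 (le_of_eq ?_))
  field_simp
  ring

lemma gaussianReal_lower_tail_le (m : ℝ) {s : ℝ} (hs : 0 < s) {n : ℕ} (hn : 0 < n)
    {d : ℝ} (hd : 0 ≤ d) :
    (gaussianReal m (s ^ 2 / (n : ℝ)).toNNReal).real {x | x ≤ m - d} ≤
      Real.exp (-(d ^ 2 / (2 * s ^ 2)) * n) := by
  have hn' : (0 : ℝ) < n := by exact_mod_cast hn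
  have h := measure_le_le_exp_mul_mgf (μ := gaussianReal m (s ^ 2 / (n : ℝ)).toNNReal)
    (X := id) (t := -(d * n / s ^ 2)) (m - d) (neg_nonpos.2 (by positivity))
    (integrable_exp_mul_gaussianReal _)
  rw [mgf_id_gaussianReal, ← Real.exp_add, Real.coe_toNNReal _ (by positivity)] at h
  refine h.trans (Real.exp_le_exp.2 (le_of_eq ?_))
  field_simp
  ring

lemma le_gaussianReal_Iio (m : ℝ) {s : ℝ} (hs : 0 < s) {n : ℕ} (hn : 0 < n)
    {d : ℝ} (hd : 0 ≤ d) :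
    1 - Real.exp (-(d ^ 2 / (2 * s ^ 2))) ≤
      (gaussianReal m (s ^ 2 / (n : ℝ)).toNNReal).real (Set.Iio (m + d)) := by
  have h := gaussianReal_upper_tail_le m hs hn hd
  rw [← Set.compl_Ici, probReal_compl_eq_one_sub measurableSet_Ici]
  change _ ≤ 1 - (gaussianReal m (s ^ 2 / (n : ℝ)).toNNReal).real {x | m + d ≤ x}
  have h1 : Real.exp (-(d ^ 2 / (2 * s ^ 2)) * n) ≤ Real.exp (-(d ^ 2 / (2 * s ^ 2))) := by
    apply Real.exp_le_exp.2
    have hn' : (1 : ℝ) ≤ n := by exact_mod_cast hn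
    have : 0 ≤ d ^ 2 / (2 * s ^ 2) := by positivity
    nlinarith
  linarith

lemma le_gaussianReal_Ioi (m : ℝ) {s : ℝ} (hs : 0 < s) {n : ℕ} (hn : 0 < n)
    {d δ : ℝ} (hd : 0 ≤ d) (hδ : 0 < δ) :
    (√(2 * Real.pi * s ^ 2))⁻¹ * δ * Real.exp (-((d + δ) ^ 2 / (2 * s ^ 2)) * n) ≤
      (gaussianReal m (s ^ 2 / (n : ℝ)).toNNReal).real (Set.Ioi (m + d)) := by
  have hn' : (0 : ℝ) < n := by exact_mod_cast hn
  have hn1 : (1 : ℝ) ≤ n := by exact_mod_cast hn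
  have hv : (s ^ 2 / (n : ℝ)).toNNReal ≠ 0 := by
    rw [Ne, Real.toNNReal_eq_zero, not_le]; positivity
  have hsub : (gaussianReal m (s ^ 2 / (n : ℝ)).toNNReal).real (Set.Ioc (m + d) (m + d + δ)) ≤
      (gaussianReal m (s ^ 2 / (n : ℝ)).toNNReal).real (Set.Ioi (m + d)) :=
    measureReal_mono Set.Ioc_subset_Ioi_self
  refine le_trans ?_ hsub
  rw [measureReal_def, gaussianReal_apply_eq_integral _ hv, ENNReal.toReal_ofReal
    (integral_nonneg fun x => gaussianPDFReal_nonneg _ _ _)]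
  have key := setIntegral_ge_of_const_le_real (μ := volume) (s := Set.Ioc (m + d) (m + d + δ))
    (f := gaussianPDFReal m (s ^ 2 / (n : ℝ)).toNNReal)
    (c := (√(2 * Real.pi * s ^ 2))⁻¹ * Real.exp (-((d + δ) ^ 2 / (2 * s ^ 2)) * n))
    measurableSet_Ioc (by simp) ?_ (integrable_gaussianPDFReal _ _).integrableOn
  · refine le_trans (le_of_eq ?_) key
    rw [Real.volume_real_Ioc_of_le (by linarith)]
    ring
  · intro x hx
    rw [gaussianPDFReal, Real.coe_toNNReal _ (by positivity)]
    have hvs : s ^ 2 / (n : ℝ) ≤ s ^ 2 := div_le_self (by positivity) hn1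
    have hsq : (x - m) ^ 2 ≤ (d + δ) ^ 2 := by
      have h1 := hx.1
      have h2 := hx.2
      apply pow_le_pow_left₀ <;> linarith
    have hexp : -((d + δ) ^ 2 / (2 * s ^ 2)) * n = -(d + δ) ^ 2 / (2 * (s ^ 2 / n)) := by
      field_simp
    rw [hexp]
    gcongr

lemma measureReal_pi_argmax_le {ι : Type*} [Fintype ι]
    (P : ι → Measure ℝ) [∀ i, IsProbabilityMeasure (P i)]
    {b j : ι} (hj : b ≠ j) (a : ℝ) :
    (Measure.pi P).real {z | ∀ i, i ≠ j → z i < z j} ≤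
      (P b).real {x | x ≤ a} + (P j).real {x | a ≤ x} := by
  have hb : (Measure.pi P).real (Function.eval b ⁻¹' {x | x ≤ a}) = (P b).real {x | x ≤ a} :=
    (measurePreserving_eval P b).measureReal_preimage measurableSet_Iic.nullMeasurableSet
  have hj' : (Measure.pi P).real (Function.eval j ⁻¹' {x | a ≤ x}) = (P j).real {x | a ≤ x} :=
    (measurePreserving_eval P j).measureReal_preimage measurableSet_Ici.nullMeasurableSet
  rw [← hb, ← hj']
  refine le_trans (measureReal_mono ?_) (measureReal_union_le _ _)
  intro z hz
  have h := hz b hj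
  rcases le_total (z b) a with h1 | h1
  · exact Or.inl h1
  · exact Or.inr (h1.trans h.le)

lemma le_measureReal_pi_argmax {ι : Type*} [Fintype ι] [DecidableEq ι]
    (P : ι → Measure ℝ) [∀ i, IsProbabilityMeasure (P i)]
    (j : ι) (a L : ℝ) (κ : ι → ℝ) (hκ : ∀ i, 0 ≤ κ i)
    (hj : L ≤ (P j).real (Set.Ioi a)) (hi : ∀ i, i ≠ j → κ i ≤ (P i).real (Set.Iio a)) :
    L * ∏ i ∈ Finset.univ.erase j, κ i ≤
      (Measure.pi P).real {z | ∀ i, i ≠ j → z i < z j} := by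
  have hsub : Set.univ.pi (fun i => if i = j then Set.Ioi a else Set.Iio a) ⊆
      {z : ι → ℝ | ∀ i, i ≠ j → z i < z j} := by
    intro z hz i hij
    have h1 := hz i trivial
    have h2 := hz j trivial
    simp only [hij, if_true, if_false, Set.mem_Iio, Set.mem_Ioi] at h1 h2
    exact h1.trans h2
  refine le_trans ?_ (measureReal_mono hsub)
  rw [measureReal_def, Measure.pi_pi, ENNReal.toReal_prod,
    ← Finset.mul_prod_erase _ _ (Finset.mem_univ j)]
  refine mul_le_mul (by simpa [measureReal_def] using hj) (Finset.prod_le_prod (fun i _ => hκ i) ?_)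
    (Finset.prod_nonneg fun i _ => hκ i) ENNReal.toReal_nonneg
  intro i h
  have hij := Finset.ne_of_mem_erase h
  simpa [hij, measureReal_def] using hi i hij

lemma eventually_exp_neg_mul_le_exp_mul_log {n : ℕ → ℕ} {r c a : ℝ}
    (hn : Tendsto (fun t => (n t : ℝ) / Real.log (t : ℝ)) atTop (𝓝 c)) (ha : -(r * c) < a) :
    ∀ᶠ t : ℕ in atTop, Real.exp (-r * n t) ≤ Real.exp (a * Real.log t) := by
  have hlog : Tendsto (fun t : ℕ => Real.log (t : ℝ)) atTop atTop :=
    Real.tendsto_log_atTop.comp tendsto_natCast_atTop_atTop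
  have h := (hn.const_mul (-r)).eventually_lt_const (u := a) (by linarith)
  filter_upwards [h, hlog.eventually_gt_atTop 0] with t h1 h2
  apply Real.exp_le_exp.2
  rw [← mul_div_assoc, div_lt_iff₀ h2] at h1
  exact h1.le

lemma eventually_exp_neg_mul_le_exp_mul_log_of_div_tendsto_one {n : ℕ → ℕ} {r : ℝ} (a : ℝ)
    (hr : 0 < r) (hn : Tendsto (fun t => (n t : ℝ) / (t : ℝ)) atTop (𝓝 1)) :
    ∀ᶠ t : ℕ in atTop, Real.exp (-r * n t) ≤ Real.exp (a * Real.log t) := by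
  have hlog : Tendsto (fun t : ℕ => Real.log (t : ℝ) / t) atTop (𝓝 0) :=
    (Real.isLittleO_log_id_atTop.tendsto_div_nhds_zero).comp tendsto_natCast_atTop_atTop
  have h := ((hn.const_mul (-r)).sub (hlog.const_mul a)).eventually_lt_const (u := 0)
    (by linarith)
  filter_upwards [h, eventually_gt_atTop 0] with t h1 h2
  have ht : (0 : ℝ) < t := by exact_mod_cast h2
  apply Real.exp_le_exp.2
  have : (-r * n t - a * Real.log t) / t < 0 := by
    calc _ = _ := by ring
      _ < 0 := h1
  rw [div_lt_iff₀ ht] at this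
  linarith



/-- `k ≥ 2` designs with unique best design `b` and `σ i > 0`.  At stage
`t`, the sample means `Z i (t)` are independent Gaussians with mean `μ i` and variance
`σ i² / N i t` (modelled by the product measure below), and
`EOC t = ∑_j (μ b − μ j) · P(∀ i ≠ j, Z i (t) < Z j (t))`.  If `N b t / t → 1` and for each
`i ≠ b` `N i t / log t → c i > 0`, then
`(log EOC t)/(log t) → −(1/2) · min_{i ≠ b} (μ b − μ i)² c i / σ i²`. -/
theorem stmt10
    (k : ℕ) (hk : 2 ≤ k)
    (μ σ : Fin k → ℝ) (b : Fin k)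
    (hb : ∀ i, i ≠ b → μ i < μ b)
    (hσ : ∀ i, 0 < σ i)
    (N : Fin k → ℕ → ℕ) (hNpos : ∀ i t, 0 < N i t)
    (hNb : Tendsto (fun t => (N b t : ℝ) / (t : ℝ)) atTop (𝓝 1))
    (c : Fin k → ℝ) (hc : ∀ i, i ≠ b → 0 < c i)
    (hNc : ∀ i, i ≠ b →
      Tendsto (fun t => (N i t : ℝ) / Real.log (t : ℝ)) atTop (𝓝 (c i)))
    (EOC : ℕ → ℝ)
    (hEOC : ∀ t, EOC t =
      ∑ j, (μ b - μ j) *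
        ((Measure.pi fun i => gaussianReal (μ i) ((σ i ^ 2 / (N i t : ℝ)).toNNReal))
          {z | ∀ i, i ≠ j → z i < z j}).toReal) :
    Tendsto (fun t : ℕ => Real.log (EOC t) / Real.log (t : ℝ)) atTop
      (𝓝 (-(1 / 2) * ⨅ i : {i : Fin k // i ≠ b},
        (μ b - μ i.1) ^ 2 * c i.1 / σ i.1 ^ 2)) := by
  have : Nonempty {i : Fin k // i ≠ b} := by
    have : Nontrivial (Fin k) := Fin.nontrivial_iff_two_le.2 hk
    obtain ⟨i, hi⟩ := exists_ne b
    exact ⟨⟨i, hi⟩⟩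
  have hlog : Tendsto (fun t : ℕ => Real.log (t : ℝ)) atTop atTop :=
    Real.tendsto_log_atTop.comp tendsto_natCast_atTop_atTop
  have hnn : ∀ j, 0 ≤ μ b - μ j := by
    intro j
    rcases eq_or_ne j b with rfl | h
    · simp
    · linarith [hb j h]
  have lower : ∀ j, j ≠ b → ∀ δ : ℝ, 0 < δ → ∃ K : ℝ, 0 < K ∧ ∀ t,
      K * Real.exp (-((μ b - μ j + δ + δ) ^ 2 / (2 * σ j ^ 2)) * N j t) ≤ EOC t := by
    intro j hj δ hδ
    set κ : Fin k → ℝ := fun i => 1 - Real.exp (-((μ b - μ i + δ) ^ 2 / (2 * σ i ^ 2))) with hκ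
    have hκpos : ∀ i, 0 < κ i := by
      intro i
      have := hσ i
      have := hnn i
      have : 0 < (μ b - μ i + δ) ^ 2 / (2 * σ i ^ 2) := by positivity
      simpa [hκ] using this
    have hs := hσ j
    have hd : 0 < μ b - μ j := by linarith [hb j hj]
    refine ⟨(μ b - μ j) * ((√(2 * Real.pi * σ j ^ 2))⁻¹ * δ *
      ∏ i ∈ Finset.univ.erase j, κ i), ?_, ?_⟩
    · have := Finset.prod_pos (s := Finset.univ.erase j) fun i _ => hκpos i
      positivity
    · intro t
      have h := le_measureReal_pi_argmax
        (fun i => gaussianReal (μ i) ((σ i ^ 2 / (N i t : ℝ)).toNNReal)) j (μ b + δ)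
        ((√(2 * Real.pi * σ j ^ 2))⁻¹ * δ *
          Real.exp (-((μ b - μ j + δ + δ) ^ 2 / (2 * σ j ^ 2)) * N j t))
        κ (fun i => (hκpos i).le) ?_ ?_
      · rw [hEOC t]
        refine le_trans ?_ (Finset.single_le_sum
          (f := fun j => (μ b - μ j) *
            ((Measure.pi fun i => gaussianReal (μ i) ((σ i ^ 2 / (N i t : ℝ)).toNNReal))
              {z | ∀ i, i ≠ j → z i < z j}).toReal)
          (fun i _ => mul_nonneg (hnn i) ENNReal.toReal_nonneg) (Finset.mem_univ j))
        refine le_trans (le_of_eq ?_) (mul_le_mul_of_nonneg_left h hd.le)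
        ring
      · have := le_gaussianReal_Ioi (μ j) hs (hNpos j t) (d := μ b - μ j + δ) (δ := δ)
          (by linarith) hδ
        rwa [show μ j + (μ b - μ j + δ) = μ b + δ by ring] at this
      · intro i _
        have := le_gaussianReal_Iio (μ i) (hσ i) (hNpos i t) (d := μ b - μ i + δ)
          (by linarith [hnn i])
        rwa [show μ i + (μ b - μ i + δ) = μ b + δ by ring] at this
  have hEOCpos : ∀ t, 0 < EOC t := by
    intro t
    obtain ⟨j, hj⟩ := ‹Nonempty {i : Fin k // i ≠ b}›
    obtain ⟨K, hK, h⟩ := lower j hj 1 one_pos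
    exact lt_of_lt_of_le (by positivity) (h t)
  rw [tendsto_order]
  constructor
  · intro a ha
    obtain ⟨⟨j, hj⟩, hjm⟩ := exists_eq_ciInf_of_finite
      (f := fun i : {i : Fin k // i ≠ b} => (μ b - μ i.1) ^ 2 * c i.1 / σ i.1 ^ 2)
    rw [← hjm] at ha
    have hs := hσ j
    have hcont : Tendsto
        (fun δ : ℝ => -((μ b - μ j + δ + δ) ^ 2 / (2 * σ j ^ 2)) * c j) (𝓝[>] 0)
        (𝓝 (-((μ b - μ j + 0 + 0) ^ 2 / (2 * σ j ^ 2)) * c j)) :=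
      (Continuous.tendsto (by fun_prop) 0).mono_left nhdsWithin_le_nhds
    obtain ⟨δ, hδa, hδ⟩ := ((hcont.eventually_const_lt (u := a) (by
      refine ha.trans_eq ?_
      simp only [add_zero]
      field_simp)).and self_mem_nhdsWithin).exists
    obtain ⟨K, hK, h⟩ := lower j hj δ hδ
    have hlim : Tendsto (fun t : ℕ => Real.log K / Real.log (t : ℝ) +
        -((μ b - μ j + δ + δ) ^ 2 / (2 * σ j ^ 2)) * ((N j t : ℝ) / Real.log (t : ℝ))) atTop
        (𝓝 (0 + -((μ b - μ j + δ + δ) ^ 2 / (2 * σ j ^ 2)) * c j)) :=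
      (hlog.const_div_atTop _).add ((hNc j hj).const_mul _)
    filter_upwards [hlim.eventually_const_lt (u := a) (by simpa using hδa),
      hlog.eventually_gt_atTop 0] with t h1 h2
    refine h1.trans_le ?_
    have h3 := Real.log_le_log (by positivity) (h t)
    rw [Real.log_mul hK.ne' (Real.exp_ne_zero _), Real.log_exp] at h3
    rw [← mul_div_assoc, ← add_div]
    gcongr
  · intro a ha
    obtain ⟨a', ha', haa⟩ := exists_between ha
    have hterm : ∀ j, ∀ᶠ t : ℕ in atTop, (μ b - μ j) *
        ((Measure.pi fun i => gaussianReal (μ i) ((σ i ^ 2 / (N i t : ℝ)).toNNReal))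
          {z | ∀ i, i ≠ j → z i < z j}).toReal ≤
        2 * (μ b - μ j) * Real.exp (a' * Real.log t) := by
      intro j
      rcases eq_or_ne j b with rfl | hj
      · simp
      have hs := hσ j
      have hsb := hσ b
      have hd : 0 < μ b - μ j := by linarith [hb j hj]
      have hcont : Tendsto
          (fun δ : ℝ => -((μ b - μ j - δ) ^ 2 / (2 * σ j ^ 2) * c j)) (𝓝[>] 0)
          (𝓝 (-((μ b - μ j - 0) ^ 2 / (2 * σ j ^ 2) * c j))) :=
        (Continuous.tendsto (by fun_prop) 0).mono_left nhdsWithin_le_nhds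
      have hinf : (⨅ i : {i : Fin k // i ≠ b}, (μ b - μ i.1) ^ 2 * c i.1 / σ i.1 ^ 2) ≤
          (μ b - μ j) ^ 2 * c j / σ j ^ 2 :=
        ciInf_le (f := fun i : {i : Fin k // i ≠ b} => (μ b - μ i.1) ^ 2 * c i.1 / σ i.1 ^ 2)
          (Set.finite_range _).bddBelow ⟨j, hj⟩
      have hrate : -((μ b - μ j - 0) ^ 2 / (2 * σ j ^ 2) * c j) < a' := by
        have : -((μ b - μ j - 0) ^ 2 / (2 * σ j ^ 2) * c j) =
            -(1 / 2) * ((μ b - μ j) ^ 2 * c j / σ j ^ 2) := by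
          rw [sub_zero]; field_simp
        linarith
      obtain ⟨δ, ⟨hδa, hδd⟩, hδ⟩ := (((hcont.eventually_lt_const hrate).and
        (nhdsWithin_le_nhds (eventually_lt_nhds hd))).and self_mem_nhdsWithin).exists
      replace hδ : 0 < δ := hδ
      filter_upwards [eventually_exp_neg_mul_le_exp_mul_log (hNc j hj) hδa,
        eventually_exp_neg_mul_le_exp_mul_log_of_div_tendsto_one (r := δ ^ 2 / (2 * σ b ^ 2)) a'
          (by positivity) hNb] with t h1 h2
      have h := measureReal_pi_argmax_le
        (fun i => gaussianReal (μ i) ((σ i ^ 2 / (N i t : ℝ)).toNNReal)) hj.symm (μ b - δ)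
      have h3 := gaussianReal_lower_tail_le (μ b) hsb (hNpos b t) hδ.le
      have h4 := gaussianReal_upper_tail_le (μ j) hs (hNpos j t) (d := μ b - μ j - δ)
        (by linarith)
      rw [show μ j + (μ b - μ j - δ) = μ b - δ by ring] at h4
      rw [mul_comm 2, mul_assoc]
      refine mul_le_mul_of_nonneg_left (h.trans ?_) hd.le
      linarith
    set C : ℝ := ∑ j, 2 * (μ b - μ j) with hC
    have hCpos : 0 < C := by
      obtain ⟨j, hj⟩ := ‹Nonempty {i : Fin k // i ≠ b}›
      exact Finset.sum_pos' (fun i _ => by linarith [hnn i])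
        ⟨j, Finset.mem_univ j, by linarith [hb j hj]⟩
    have hlim : Tendsto (fun t : ℕ => Real.log C / Real.log (t : ℝ) + a') atTop
        (𝓝 (0 + a')) := (hlog.const_div_atTop _).add_const _
    filter_upwards [eventually_all.2 hterm, hlim.eventually_lt_const (u := a) (by simpa using haa),
      hlog.eventually_gt_atTop 0] with t h1 h2 h3
    refine lt_of_le_of_lt ?_ h2
    have h4 : EOC t ≤ C * Real.exp (a' * Real.log t) := by
      rw [hEOC t, hC, Finset.sum_mul]
      exact Finset.sum_le_sum fun j _ => h1 j
    have h5 := Real.log_le_log (hEOCpos t) h4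
    rw [Real.log_mul hCpos.ne' (Real.exp_ne_zero _), Real.log_exp] at h5
    rw [div_le_iff₀ h3, add_mul, div_mul_cancel₀ _ h3.ne']
    exact h5
end

section
/- There exists exactly one vector α = (α_1,…,α_k) with α_i > 0 for all i and ∑_{i=1}^k α_i = 1 satisfying the OCBA optimality conditions, namely (α_b/σ_b)² = ∑_{i≠b} (α_i/σ_i)² and (μ_b−μ_i)²/(σ_i²/α_i + σ_b²/α_b) = (μ_b−μ_j)²/(σ_j²/α_j + σ_b²/α_b) for all i, j ≠ b. -/
/-- For positive data over a nonempty finite set, the balance equation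
`∑ i, (σ i / (d i ^ 2 * t - c ^ 2)) ^ 2 = (1 / c) ^ 2` has a solution `t` to the right of all
the poles. -/
lemma exists_balance {ι : Type*} {s : Finset ι} (hs : s.Nonempty) {d σ : ι → ℝ} {c : ℝ}
    (hd : ∀ i ∈ s, 0 < d i) (hσ : ∀ i ∈ s, 0 < σ i) (hc : 0 < c) :
    ∃ t, (∀ i ∈ s, c ^ 2 < d i ^ 2 * t) ∧
      ∑ i ∈ s, (σ i / (d i ^ 2 * t - c ^ 2)) ^ 2 = (1 / c) ^ 2 := by
  obtain ⟨m, hm, hmin⟩ := s.exists_min_image d hs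
  have hdm := hd m hm
  have hσm := hσ m hm
  have hσle : σ m ≤ ∑ i ∈ s, σ i :=
    Finset.single_le_sum (f := σ) (fun i hi => (hσ i hi).le) hm
  have hS : 0 < ∑ i ∈ s, σ i := hσm.trans_le hσle
  set S := ∑ i ∈ s, σ i with hSdef
  have hle : (c ^ 2 + c * σ m) / d m ^ 2 ≤ (c ^ 2 + c * S) / d m ^ 2 := by gcongr
  have hgap : ∀ t, (c ^ 2 + c * σ m) / d m ^ 2 ≤ t → ∀ i ∈ s,
      d m ^ 2 * t - c ^ 2 ≤ d i ^ 2 * t - c ^ 2 := by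
    intro t ht i hi
    have ht0 : 0 ≤ t := le_trans (by positivity) ht
    have := hmin i hi
    gcongr
  have hpos : ∀ t, (c ^ 2 + c * σ m) / d m ^ 2 ≤ t → ∀ i ∈ s, 0 < d i ^ 2 * t - c ^ 2 := by
    intro t ht i hi
    refine lt_of_lt_of_le ?_ (hgap t ht i hi)
    rw [div_le_iff₀ (by positivity)] at ht
    nlinarith [mul_pos hc hσm]
  have hcont : ContinuousOn (fun t => ∑ i ∈ s, (σ i / (d i ^ 2 * t - c ^ 2)) ^ 2)
      (Set.Icc ((c ^ 2 + c * σ m) / d m ^ 2) ((c ^ 2 + c * S) / d m ^ 2)) := by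
    refine continuousOn_finsetSum s fun i hi => ContinuousOn.pow ?_ 2
    exact ContinuousOn.div (by fun_prop) (by fun_prop) fun t ht => (hpos t ht.1 i hi).ne'
  have hmem : (1 / c) ^ 2 ∈ Set.Icc
      (∑ i ∈ s, (σ i / (d i ^ 2 * ((c ^ 2 + c * S) / d m ^ 2) - c ^ 2)) ^ 2)
      (∑ i ∈ s, (σ i / (d i ^ 2 * ((c ^ 2 + c * σ m) / d m ^ 2) - c ^ 2)) ^ 2) := by
    constructor
    · have hterm : ∀ i ∈ s, (σ i / (d i ^ 2 * ((c ^ 2 + c * S) / d m ^ 2) - c ^ 2)) ^ 2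
          ≤ (σ i / (c * S)) ^ 2 := by
        intro i hi
        have h1 := hgap _ hle i hi
        have h2 : d m ^ 2 * ((c ^ 2 + c * S) / d m ^ 2) - c ^ 2 = c * S := by
          field_simp
          ring
        rw [h2] at h1
        have h3 := hpos _ hle i hi
        have := hσ i hi
        gcongr
      refine (Finset.sum_le_sum hterm).trans ?_
      have hsq : ∑ i ∈ s, σ i ^ 2 ≤ S ^ 2 :=
        Finset.sum_sq_le_sq_sum_of_nonneg fun i hi => (hσ i hi).le
      simp_rw [div_pow]
      rw [← Finset.sum_div, div_le_div_iff₀ (by positivity) (by positivity)]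
      nlinarith [mul_le_mul_of_nonneg_right hsq (sq_nonneg c)]
    · have h2 : σ m / (d m ^ 2 * ((c ^ 2 + c * σ m) / d m ^ 2) - c ^ 2) = 1 / c := by
        have : d m ^ 2 * ((c ^ 2 + c * σ m) / d m ^ 2) - c ^ 2 = c * σ m := by
          field_simp
          ring
        rw [this]
        field_simp
      rw [← h2]
      exact Finset.single_le_sum
        (f := fun i => (σ i / (d i ^ 2 * ((c ^ 2 + c * σ m) / d m ^ 2) - c ^ 2)) ^ 2)
        (fun i _ => sq_nonneg _) hm
  obtain ⟨t, ht, heq⟩ := intermediate_value_Icc' hle hcont hmem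
  exact ⟨t, fun i hi => sub_pos.mp (hpos t ht.1 i hi), heq⟩

/-- The left-hand side of the balance equation is strictly decreasing right of the poles. -/
lemma balance_lt {ι : Type*} {s : Finset ι} (hs : s.Nonempty) {d σ : ι → ℝ} {c t u : ℝ}
    (hd : ∀ i ∈ s, 0 < d i) (hσ : ∀ i ∈ s, 0 < σ i)
    (ht : ∀ i ∈ s, c ^ 2 < d i ^ 2 * t) (htu : t < u) :
    ∑ i ∈ s, (σ i / (d i ^ 2 * u - c ^ 2)) ^ 2 <
      ∑ i ∈ s, (σ i / (d i ^ 2 * t - c ^ 2)) ^ 2 := by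
  refine Finset.sum_lt_sum_of_nonempty hs fun i hi => ?_
  have hdi := hd i hi
  have hσi := hσ i hi
  have hpos := sub_pos.mpr (ht i hi)
  have hlt : d i ^ 2 * t - c ^ 2 < d i ^ 2 * u - c ^ 2 := by gcongr
  have hpos' := hpos.trans hlt
  gcongr

lemma balance_unique {ι : Type*} {s : Finset ι} (hs : s.Nonempty) {d σ : ι → ℝ} {c t u : ℝ}
    (hd : ∀ i ∈ s, 0 < d i) (hσ : ∀ i ∈ s, 0 < σ i)
    (ht : ∀ i ∈ s, c ^ 2 < d i ^ 2 * t) (hu : ∀ i ∈ s, c ^ 2 < d i ^ 2 * u)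
    (h : ∑ i ∈ s, (σ i / (d i ^ 2 * t - c ^ 2)) ^ 2 =
      ∑ i ∈ s, (σ i / (d i ^ 2 * u - c ^ 2)) ^ 2) : t = u := by
  rcases lt_trichotomy t u with hlt | heq | hlt
  · exact absurd h (balance_lt hs hd hσ ht hlt).ne'
  · exact heq
  · exact absurd h (balance_lt hs hd hσ hu hlt).ne

/-- A positive solution of the optimality conditions is determined, up to scaling, by the inverse
of its common rate, which solves the balance equation. -/
lemma exists_balance_of_optimal {ι : Type*} {s : Finset ι} (hs : s.Nonempty) {d σ α : ι → ℝ}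
    {c a : ℝ} (hd : ∀ i ∈ s, 0 < d i) (hσ : ∀ i ∈ s, 0 < σ i) (hα : ∀ i ∈ s, 0 < α i)
    (hc : 0 < c) (ha : 0 < a)
    (hbal : (a / c) ^ 2 = ∑ i ∈ s, (α i / σ i) ^ 2)
    (hrate : ∀ i ∈ s, ∀ j ∈ s, d i ^ 2 / (σ i ^ 2 / α i + c ^ 2 / a)
      = d j ^ 2 / (σ j ^ 2 / α j + c ^ 2 / a)) :
    ∃ t, (∀ i ∈ s, c ^ 2 < d i ^ 2 * t) ∧
      ∑ i ∈ s, (σ i / (d i ^ 2 * t - c ^ 2)) ^ 2 = (1 / c) ^ 2 ∧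
      ∀ i ∈ s, α i = σ i ^ 2 / (d i ^ 2 * t - c ^ 2) * a := by
  obtain ⟨m, hm⟩ := hs
  have hdm := hd m hm
  have hσm := hσ m hm
  have hαm := hα m hm
  have key : ∀ i ∈ s,
      d i ^ 2 * (a * (σ m ^ 2 / α m + c ^ 2 / a) / d m ^ 2) - c ^ 2 = σ i ^ 2 * a / α i := by
    intro i hi
    have hdi := hd i hi
    have hσi := hσ i hi
    have hαi := hα i hi
    have h := hrate i hi m hm
    rw [div_eq_div_iff (by positivity) (by positivity)] at h
    have h' : d i ^ 2 * (a * (σ m ^ 2 / α m + c ^ 2 / a) / d m ^ 2)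
        = a * (σ i ^ 2 / α i + c ^ 2 / a) := by
      rw [mul_div_assoc', div_eq_iff (by positivity)]
      linear_combination a * h
    rw [h']
    field_simp
    ring
  refine ⟨a * (σ m ^ 2 / α m + c ^ 2 / a) / d m ^ 2, fun i hi => ?_, ?_, fun i hi => ?_⟩
  · have hσi := hσ i hi
    have hαi := hα i hi
    rw [← sub_pos, key i hi]
    positivity
  · have hterm : ∀ i ∈ s,
        (σ i / (d i ^ 2 * (a * (σ m ^ 2 / α m + c ^ 2 / a) / d m ^ 2) - c ^ 2)) ^ 2
          = (α i / σ i) ^ 2 / a ^ 2 := by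
      intro i hi
      have hσi := hσ i hi
      have hαi := hα i hi
      rw [key i hi]
      field_simp
    rw [Finset.sum_congr rfl hterm, ← Finset.sum_div, ← hbal]
    field_simp
  · have hσi := hσ i hi
    have hαi := hα i hi
    rw [key i hi]
    field_simp


/-- `k ≥ 2` designs with unique best design `b` and `σ i > 0`.  There is
exactly one vector `α` with `α i > 0` for all `i` and `∑ i α i = 1` satisfying the OCBA
optimality conditions `(α b / σ b)² = ∑_{i ≠ b} (α i / σ i)²` and
`(μ b − μ i)²/(σ i²/α i + σ b²/α b) = (μ b − μ j)²/(σ j²/α j + σ b²/α b)` for all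
`i, j ≠ b`. -/
theorem stmt14
    (k : ℕ) (hk : 2 ≤ k)
    (μ σ : Fin k → ℝ) (b : Fin k)
    (hb : ∀ i, i ≠ b → μ i < μ b)
    (hσ : ∀ i, 0 < σ i) :
    ∃! α : Fin k → ℝ,
      (∀ i, 0 < α i) ∧
      (∑ i, α i = 1) ∧
      ((α b / σ b) ^ 2 = ∑ i ∈ Finset.univ.erase b, (α i / σ i) ^ 2) ∧
      (∀ i ∈ Finset.univ.erase b, ∀ j ∈ Finset.univ.erase b,
        (μ b - μ i) ^ 2 / (σ i ^ 2 / α i + σ b ^ 2 / α b)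
          = (μ b - μ j) ^ 2 / (σ j ^ 2 / α j + σ b ^ 2 / α b)) := by
  have hs : (Finset.univ.erase b).Nonempty := by
    rw [← Finset.card_pos, Finset.card_erase_of_mem (Finset.mem_univ b), Finset.card_univ,
      Fintype.card_fin]
    omega
  have hd : ∀ i ∈ Finset.univ.erase b, 0 < μ b - μ i :=
    fun i hi => sub_pos.mpr (hb i (Finset.ne_of_mem_erase hi))
  have hσ' : ∀ i ∈ Finset.univ.erase b, 0 < σ i := fun i _ => hσ i
  have hσb := hσ b
  obtain ⟨t, ht, hbal⟩ := exists_balance hs hd hσ' hσb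
  set r : Fin k → ℝ := fun i => σ i ^ 2 / ((μ b - μ i) ^ 2 * t - σ b ^ 2) with hr
  have hgap : ∀ i ∈ Finset.univ.erase b, 0 < (μ b - μ i) ^ 2 * t - σ b ^ 2 :=
    fun i hi => sub_pos.mpr (ht i hi)
  have hrpos : ∀ i ∈ Finset.univ.erase b, 0 < r i := fun i hi =>
    div_pos (pow_pos (hσ i) 2) (hgap i hi)
  have hR : 0 < 1 + ∑ i ∈ Finset.univ.erase b, r i :=
    add_pos one_pos (Finset.sum_pos hrpos hs)
  set a : ℝ := (1 + ∑ i ∈ Finset.univ.erase b, r i)⁻¹ with ha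
  have hapos : 0 < a := inv_pos.mpr hR
  have hne : ∀ i ∈ Finset.univ.erase b,
      (if i = b then a else r i * a) = r i * a :=
    fun i hi => if_neg (Finset.ne_of_mem_erase hi)
  refine ⟨fun i => if i = b then a else r i * a, ⟨fun i => ?_, ?_, ?_, ?_⟩, ?_⟩
  · by_cases hi : i = b
    · simpa [hi] using hapos
    · simpa [hi] using mul_pos (hrpos i (by simp [hi])) hapos
  · rw [← Finset.add_sum_erase _ _ (Finset.mem_univ b), Finset.sum_congr rfl hne,
      ← Finset.sum_mul, if_pos rfl, ha]
    field_simp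
  · have hterm : ∀ i ∈ Finset.univ.erase b, ((if i = b then a else r i * a) / σ i) ^ 2
        = (σ i / ((μ b - μ i) ^ 2 * t - σ b ^ 2)) ^ 2 * a ^ 2 := by
      intro i hi
      have hσi := hσ i
      have hgi := hgap i hi
      rw [hne i hi, hr]
      field_simp
    simp only [if_true]
    rw [Finset.sum_congr rfl hterm, ← Finset.sum_mul, hbal]
    ring
  · have hrate : ∀ i ∈ Finset.univ.erase b,
        (μ b - μ i) ^ 2 / (σ i ^ 2 / (if i = b then a else r i * a) + σ b ^ 2 / a) = a / t := by
      intro i hi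
      have hσi := hσ i
      have hgi := hgap i hi
      have hdi := hd i hi
      have hden : σ i ^ 2 / (r i * a) + σ b ^ 2 / a = (μ b - μ i) ^ 2 * t / a := by
        rw [hr]
        field_simp
        ring
      rw [hne i hi, hden]
      field_simp
    intro i hi j hj
    simp only [if_true]
    rw [hrate i hi, hrate j hj]
  · rintro β ⟨hβ, hβsum, hβbal, hβrate⟩
    obtain ⟨u, hu, hubal, hβu⟩ := exists_balance_of_optimal hs hd hσ' (fun i _ => hβ i) hσb
      (hβ b) hβbal hβrate
    obtain rfl : t = u := balance_unique hs hd hσ' ht hu (hbal.trans hubal.symm)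
    have hβb : β b = a := by
      rw [← Finset.add_sum_erase _ _ (Finset.mem_univ b), Finset.sum_congr rfl hβu,
        ← Finset.sum_mul] at hβsum
      rw [ha]
      refine eq_inv_of_mul_eq_one_left ?_
      linear_combination hβsum
    funext i
    by_cases hi : i = b
    · simp [hi, hβb]
    · simp only [hi, if_false]
      rw [hβu i (by simp [hi]), hβb]
end

section
/- Under the OCBA-1 sampling dynamics driven by weight sequences a_i(t) that converge to strictly positive limits a_i, every design is sampled infinitely often; that is, N_i(t) → ∞ as t → ∞ for every i ∈ {1,…,k}. -/
open Filter Topology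

/-- OCBA-1 sampling dynamics: `k ≥ 2` designs, increment `Δ ≥ 1`,
initial count `n₀ ≥ 1`; nonnegative weights `w i t` summing to `1` over `i`, converging to
strictly positive limits `wLim i`; at each step the chosen design `I t` maximizes
`w i t (1 + ∑ j N j t) − N i t`, and its counter is increased by `Δ`.  Then every design is
sampled infinitely often: `N i t → ∞` for every `i`. -/
theorem stmt15
    (k : ℕ) (hk : 2 ≤ k)
    (Δ : ℕ) (hΔ : 1 ≤ Δ) (n₀ : ℕ) (hn₀ : 1 ≤ n₀)
    (w : Fin k → ℕ → ℝ) (wLim : Fin k → ℝ)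
    (hw_nonneg : ∀ i t, 0 ≤ w i t)
    (hw_sum : ∀ t, ∑ i, w i t = 1)
    (hw_lim : ∀ i, Tendsto (fun t => w i t) atTop (𝓝 (wLim i)))
    (hwLim_pos : ∀ i, 0 < wLim i)
    (N : Fin k → ℕ → ℕ) (I : ℕ → Fin k)
    (hN0 : ∀ i, N i 0 = n₀)
    (hargmax : ∀ t i,
      w i t * (1 + ∑ j, (N j t : ℝ)) - (N i t : ℝ)
        ≤ w (I t) t * (1 + ∑ j, (N j t : ℝ)) - (N (I t) t : ℝ))
    (hstep : ∀ t, N (I t) (t + 1) = N (I t) t + Δ)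
    (hstep' : ∀ t j, j ≠ I t → N j (t + 1) = N j t) :
    ∀ i, Tendsto (fun t => N i t) atTop atTop := by
  have hmono : ∀ i, Monotone (N i) := fun i => monotone_nat_of_le_succ fun t => by
    by_cases h : i = I t
    · rw [h, hstep]; omega
    · exact (hstep' t i h).ge
  have hSmono : Monotone fun t => 1 + ∑ j, (N j t : ℝ) := fun s t hst => by
    have := Finset.sum_le_sum fun j (_ : j ∈ Finset.univ) =>
      (Nat.cast_le (α := ℝ)).2 (hmono j hst)
    simpa using this
  have hSge : ∀ t : ℕ, (t : ℝ) ≤ 1 + ∑ j, (N j t : ℝ) := by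
    intro t
    induction t with
    | zero => push_cast; positivity
    | succ t ih =>
      have hlt : ∑ j, N j t < ∑ j, N j (t + 1) :=
        Finset.sum_lt_sum (fun j _ => hmono j t.le_succ)
          ⟨I t, Finset.mem_univ _, by rw [hstep]; omega⟩
      have hlt' : (∑ j, (N j t : ℝ)) + 1 ≤ ∑ j, (N j (t + 1) : ℝ) := by exact_mod_cast hlt
      push_cast
      linarith
  have hlim_sum : ∑ i, wLim i = 1 := by
    have h := tendsto_finsetSum Finset.univ fun i _ => hw_lim i
    simp only [hw_sum] at h
    exact tendsto_nhds_unique h tendsto_const_nhds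
  -- The gaps sum to one, so the selected design has a nonnegative gap.
  have hsel : ∀ t, (N (I t) t : ℝ) ≤ w (I t) t * (1 + ∑ j, (N j t : ℝ)) := by
    intro t
    by_contra! hlt
    have h := Finset.sum_nonpos fun i (_ : i ∈ Finset.univ) =>
      (hargmax t i).trans (sub_neg.2 hlt).le
    rw [Finset.sum_sub_distrib, ← Finset.sum_mul, hw_sum] at h
    linarith
  intro i
  refine tendsto_atTop_atTop_of_monotone (hmono i) ?_
  by_contra! hbdd
  obtain ⟨b, hb⟩ := hbdd
  have hk0 : (0 : ℝ) < k := by exact_mod_cast (by omega : 0 < k)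
  obtain ⟨ε, hε, hkε⟩ : ∃ ε : ℝ, 0 < ε ∧ k * ε = wLim i / 2 :=
    ⟨wLim i / 2 / k, by have := hwLim_pos i; positivity, by field_simp⟩
  obtain ⟨T, hT⟩ : ∃ T, ∀ t ≥ T, ∀ j, w j t ≤ wLim j + ε :=
    eventually_atTop.1 (eventually_all.2 fun j =>
      (hw_lim j).eventually_le_const (lt_add_of_pos_right _ hε))
  set C : ℝ := ∑ j, (N j T : ℝ) + Δ with hC
  have hC0 : 0 ≤ C := by positivity
  have hS0 : ∀ t, 0 ≤ 1 + ∑ j, (N j t : ℝ) := fun t => by positivity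
  have hub : ∀ t ≥ T, ∀ j, (N j t : ℝ) ≤ (wLim j + ε) * (1 + ∑ j, (N j t : ℝ)) + C := by
    intro t ht
    induction t, ht using Nat.le_induction with
    | base =>
      intro j
      have h1 := Finset.single_le_sum (f := fun j => (N j T : ℝ))
        (fun j _ => Nat.cast_nonneg _) (Finset.mem_univ j)
      have h2 := mul_nonneg (add_pos (hwLim_pos j) hε).le (hS0 T)
      have h3 : (0 : ℝ) ≤ Δ := Nat.cast_nonneg _
      linarith
    | succ t ht ih =>
      intro j
      have hmul := mul_le_mul_of_nonneg_left (hSmono t.le_succ) (add_pos (hwLim_pos j) hε).le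
      simp only at hmul
      by_cases h : j = I t
      · have h1 := hsel t
        have h2 := mul_le_mul_of_nonneg_right (hT t ht (I t)) (hS0 t)
        have h3 : (Δ : ℝ) ≤ C := le_add_of_nonneg_left (by positivity)
        have h4 : (N (I t) (t + 1) : ℝ) = N (I t) t + Δ := by exact_mod_cast hstep t
        subst h
        linarith
      · rw [hstep' t j h]
        linarith [ih j]
  -- Summing these bounds, with the bound `b` used at `i`, bounds the total count.
  have htotal : ∀ t ≥ T, wLim i / 2 * (1 + ∑ j, (N j t : ℝ)) ≤ 1 + k * C + b := by
    intro t ht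
    set S := 1 + ∑ j, (N j t : ℝ) with hS
    have hS0' : 0 ≤ S := hS0 t
    have hle : ∀ j ∈ Finset.univ,
        (N j t : ℝ) ≤ (wLim j + ε) * S + C + if j = i then b - wLim i * S else 0 := by
      intro j _
      split_ifs with h
      · subst h
        have h1 : (N j t : ℝ) ≤ b := by exact_mod_cast (hb t).le
        nlinarith [mul_nonneg hε.le hS0']
      · linarith [hub t ht j]
    have hsum := Finset.sum_le_sum hle
    simp only [Finset.sum_add_distrib, ← Finset.sum_mul, hlim_sum, Finset.sum_const,
      Finset.card_univ, Fintype.card_fin, nsmul_eq_mul, hkε, Finset.sum_ite_eq',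
      Finset.mem_univ, if_true] at hsum
    linarith
  obtain ⟨n, hn⟩ := exists_nat_gt ((1 + k * C + b) / (wLim i / 2))
  have hpos : 0 < wLim i / 2 := half_pos (hwLim_pos i)
  have h1 := htotal (max n T) (le_max_right _ _)
  have h2 := (hSge n).trans (hSmono (le_max_left n T))
  have h3 := mul_le_mul_of_nonneg_left h2 hpos.le
  rw [div_lt_iff₀ hpos] at hn
  simp only at h3
  linarith
end

section
/- Under the OCBA-1 sampling dynamics driven by weight sequences a_i(t) that converge to strictly positive limits a_i, the allocation fractions converge to the limit weights; that is, N_i(t)/∑_{j=1}^k N_j(t) → a_i as t → ∞ for every i ∈ {1,…,k}. -/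
open Filter Topology

/-- Functions with constant sum that are asymptotically bounded above by constants of the same sum
converge to these constants. -/
lemma tendsto_of_sum_eq_of_eventually_le {ι α : Type*} [Fintype ι] {l : Filter α}
    {x : ι → α → ℝ} {a : ι → ℝ} (hsum : ∀ᶠ t in l, ∑ i, x i t = ∑ i, a i)
    (hle : ∀ i, ∀ ε > 0, ∀ᶠ t in l, x i t ≤ a i + ε) (i : ι) :
    Tendsto (x i) l (𝓝 (a i)) := by
  classical
  rw [Metric.tendsto_nhds]
  intro ε hε
  set δ := ε / (Fintype.card ι + 1) with hδ
  have hc : (0 : ℝ) < Fintype.card ι + 1 := by positivity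
  have hδ0 : 0 < δ := by positivity
  have hδε : Fintype.card ι * δ < ε := by
    have : (Fintype.card ι + 1) * δ = ε := by rw [hδ]; field_simp
    linarith
  have hall : ∀ᶠ t in l, ∀ j, x j t ≤ a j + δ := eventually_all.2 fun j => hle j δ hδ0
  have hcard : (1 : ℝ) ≤ Fintype.card ι := by
    exact_mod_cast Fintype.card_pos_iff.2 ⟨i⟩
  filter_upwards [hall, hsum] with t ht hs
  have hsingle : a i + δ - x i t ≤ ∑ j, (a j + δ - x j t) :=
    Finset.single_le_sum (f := fun j => a j + δ - x j t)
      (fun j _ => sub_nonneg.2 (ht j)) (Finset.mem_univ i)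
  have htotal : ∑ j, (a j + δ - x j t) = Fintype.card ι * δ := by
    simp [Finset.sum_sub_distrib, Finset.sum_add_distrib, hs]
  rw [Real.dist_eq, abs_lt]
  constructor <;> nlinarith [ht i]

/-- If the weights `w` and the counts `n` satisfy `∑ w = 1`, a maximizer of
`w i * (1 + ∑ n) - n i` has a nonnegative value. -/
lemma le_mul_one_add_sum_of_forall_le {ι : Type*} [Fintype ι] {w n : ι → ℝ} {m : ι}
    (hw : ∑ i, w i = 1)
    (hm : ∀ i, w i * (1 + ∑ j, n j) - n i ≤ w m * (1 + ∑ j, n j) - n m) :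
    n m ≤ w m * (1 + ∑ j, n j) := by
  by_contra! h
  have hneg : ∑ i, (w i * (1 + ∑ j, n j) - n i) ≤ 0 :=
    Finset.sum_nonpos fun i _ => (hm i).trans (by linarith)
  rw [Finset.sum_sub_distrib, ← Finset.sum_mul, hw] at hneg
  linarith

/-- OCBA-1 sampling dynamics: `k ≥ 2` designs, increment `Δ ≥ 1`,
initial count `n₀ ≥ 1`; nonnegative weights `w i t` summing to `1` over `i`, converging to
strictly positive limits `wLim i`; at each step the chosen design `I t` maximizes
`w i t (1 + ∑ j N j t) − N i t`, and its counter is increased by `Δ`.  Then the allocation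
fractions converge to the limit weights: `N i t / ∑ j N j t → wLim i` for every `i`. -/
theorem stmt16
    (k : ℕ) (hk : 2 ≤ k)
    (Δ : ℕ) (hΔ : 1 ≤ Δ) (n₀ : ℕ) (hn₀ : 1 ≤ n₀)
    (w : Fin k → ℕ → ℝ) (wLim : Fin k → ℝ)
    (hw_nonneg : ∀ i t, 0 ≤ w i t)
    (hw_sum : ∀ t, ∑ i, w i t = 1)
    (hw_lim : ∀ i, Tendsto (fun t => w i t) atTop (𝓝 (wLim i)))
    (hwLim_pos : ∀ i, 0 < wLim i)
    (N : Fin k → ℕ → ℕ) (I : ℕ → Fin k)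
    (hN0 : ∀ i, N i 0 = n₀)
    (hargmax : ∀ t i,
      w i t * (1 + ∑ j, (N j t : ℝ)) - (N i t : ℝ)
        ≤ w (I t) t * (1 + ∑ j, (N j t : ℝ)) - (N (I t) t : ℝ))
    (hstep : ∀ t, N (I t) (t + 1) = N (I t) t + Δ)
    (hstep' : ∀ t j, j ≠ I t → N j (t + 1) = N j t) :
    ∀ i, Tendsto (fun t => (N i t : ℝ) / ∑ j, (N j t : ℝ)) atTop (𝓝 (wLim i)) := by
  set S : ℕ → ℝ := fun t => ∑ j, (N j t : ℝ) with hS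
  have hSsucc (t : ℕ) : S (t + 1) = S t + Δ := by
    have hN (j : Fin k) : (N j (t + 1) : ℝ) = N j t + if j = I t then (Δ : ℝ) else 0 := by
      split_ifs with h
      · subst h; exact_mod_cast hstep t
      · rw [hstep' t j h, add_zero]
    simp [hS, hN, Finset.sum_add_distrib]
  have hSnonneg (t : ℕ) : 0 ≤ S t := Finset.sum_nonneg fun j _ => Nat.cast_nonneg _
  have hΔ' : (1 : ℝ) ≤ Δ := by exact_mod_cast hΔ
  have hSge (t : ℕ) : (t : ℝ) ≤ S t := by
    induction t with
    | zero => simpa using hSnonneg 0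
    | succ t ih => rw [hSsucc]; push_cast; linarith
  have hStop : Tendsto S atTop atTop := tendsto_atTop_mono hSge tendsto_natCast_atTop_atTop
  have hlim_sum : ∑ i, wLim i = 1 := by
    refine tendsto_nhds_unique (tendsto_finsetSum _ fun i _ => hw_lim i) ?_
    simp [hw_sum]
  have hchosen (t : ℕ) : (N (I t) t : ℝ) ≤ w (I t) t * (1 + S t) :=
    le_mul_one_add_sum_of_forall_le (w := fun i => w i t) (n := fun i => (N i t : ℝ))
      (hw_sum t) (hargmax t)
  refine tendsto_of_sum_eq_of_eventually_le ?_ ?_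
  · filter_upwards [hStop.eventually_gt_atTop 0] with t ht
    rw [← Finset.sum_div, hlim_sum]
    exact div_self ht.ne'
  · intro i ε hε
    obtain ⟨T, hT⟩ := eventually_atTop.1 ((hw_lim i).eventually_le_const
      (show wLim i < wLim i + ε / 2 by linarith))
    set b := wLim i + ε / 2 with hb
    have hb0 : 0 < b := by linarith [hwLim_pos i]
    have hbound : ∀ t ≥ T, (N i t : ℝ) ≤ b * (1 + S t) + (N i T + Δ) := by
      intro t ht
      induction t, ht using Nat.le_induction with
      | base => nlinarith [mul_nonneg hb0.le (hSnonneg T)]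
      | succ t ht ih =>
        have hmono : b * (1 + S t) ≤ b * (1 + S (t + 1)) := by
          rw [hSsucc]; gcongr; linarith
        by_cases h : i = I t
        · have h1 : (N i (t + 1) : ℝ) = N i t + Δ := by
            subst h; exact_mod_cast hstep t
          have h2 : (N i t : ℝ) ≤ w i t * (1 + S t) := by subst h; exact hchosen t
          have h3 : w i t * (1 + S t) ≤ b * (1 + S t) :=
            mul_le_mul_of_nonneg_right (hT t ht) (by linarith [hSnonneg t])
          linarith [Nat.cast_nonneg (α := ℝ) (N i T)]
        · rw [hstep' t i h]
          linarith
    filter_upwards [hStop.eventually_gt_atTop 0, eventually_ge_atTop T,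
      hStop.eventually_ge_atTop ((b + (N i T + Δ)) / (ε / 2))] with t hpos ht hlarge
    rw [div_le_iff₀ (by linarith)] at hlarge
    change (N i t : ℝ) / S t ≤ _
    rw [div_le_iff₀ hpos]
    have := hbound t ht
    rw [hb] at this hlarge
    linarith
end

section
/- Under the OCBA-2 sampling dynamics driven by estimate sequences m_i(t) converging to pairwise distinct limits m_i, every design is sampled infinitely often, i.e. N_i(t) → ∞ as t → ∞ for every i ∈ {1,…,k}, and moreover b̂(t) equals the index of the largest limit m_i for all sufficiently large t. -/
open Filter Topology

/-- A natural-number sequence that is monotone and unbounded tends to infinity. -/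
theorem Monotone.tendsto_atTop_of_not_bounded {f : ℕ → ℕ} (hf : Monotone f)
    (h : ¬∃ C, ∀ t, f t ≤ C) : Tendsto f atTop atTop := by
  push Not at h
  exact tendsto_atTop_atTop_of_monotone hf fun C => (h C).imp fun _ ht => ht.le

section SequentialSampling

variable {ι : Type*} {Δ : ℕ} {N : ι → ℕ → ℕ} {I : ℕ → ι}

theorem sampling_count_monotone (hstep : ∀ t, N (I t) (t + 1) = N (I t) t + Δ)
    (hstep' : ∀ t j, j ≠ I t → N j (t + 1) = N j t) (i : ι) : Monotone (N i) := by
  refine monotone_nat_of_le_succ fun t => ?_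
  by_cases h : i = I t
  · rw [h, hstep]
    omega
  · rw [hstep' t i h]

theorem sampling_count_bounded_of_eventually_ne
    (hmono : ∀ i, Monotone (N i))
    (hstep' : ∀ t j, j ≠ I t → N j (t + 1) = N j t) {i : ι}
    (h : ∀ᶠ t in atTop, I t ≠ i) : ∃ C, ∀ t, N i t ≤ C := by
  obtain ⟨T, hT⟩ := eventually_atTop.1 h
  have hconst : ∀ t, T ≤ t → N i t = N i T := fun t ht => by
    induction t, ht using Nat.le_induction with
    | base => rfl
    | succ t ht ih => rw [hstep' t i (hT t ht).symm, ih]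
  refine ⟨N i T, fun t => ?_⟩
  rcases le_total T t with ht | ht
  · exact (hconst t ht).le
  · exact hmono i ht

theorem sampling_counts_not_all_bounded [Fintype ι] (hΔ : 1 ≤ Δ)
    (hmono : ∀ i, Monotone (N i))
    (hstep : ∀ t, N (I t) (t + 1) = N (I t) t + Δ) :
    ¬∀ i, ∃ C, ∀ t, N i t ≤ C := by
  intro h
  choose C hC using h
  have hS : StrictMono fun t => ∑ i, N i t :=
    strictMono_nat_of_lt_succ fun t =>
      Finset.sum_lt_sum (fun i _ => hmono i t.le_succ)
        ⟨I t, Finset.mem_univ _, by rw [hstep]; omega⟩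
  have h₁ := hS.le_apply (x := ∑ i, C i + 1)
  have h₂ : ∑ i, N i (∑ i, C i + 1) ≤ ∑ i, C i := Finset.sum_le_sum fun i _ => hC i _
  exact absurd (h₁.trans h₂) (Nat.not_succ_le_self _)

end SequentialSampling

theorem eventually_eq_argmax_of_tendsto {ι : Type*} [Finite ι] {m : ι → ℕ → ℝ} {mLim : ι → ℝ}
    (hm_lim : ∀ i, Tendsto (fun t => m i t) atTop (𝓝 (mLim i)))
    {b : ι} (hb : ∀ i, i ≠ b → mLim i < mLim b) {bhat : ℕ → ι}
    (hbhat : ∀ t i, m i t ≤ m (bhat t) t) : ∀ᶠ t in atTop, bhat t = b := by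
  have h : ∀ᶠ t in atTop, ∀ i, i ≠ b → m i t < m b t := by
    refine eventually_all.2 fun i => ?_
    by_cases hi : i = b
    · exact Eventually.of_forall fun _ h => absurd hi h
    · exact ((hm_lim i).eventually_lt (hm_lim b) (hb i hi)).mono fun _ h _ => h
  filter_upwards [h] with t ht
  by_contra hne
  exact (ht _ hne).not_ge (hbhat t b)

/-- OCBA-2 sampling dynamics: `k ≥ 2` designs, increment `Δ ≥ 1`,
initial count `n₀ ≥ 1`, `σ i > 0`; estimates `m i t` pairwise distinct for each `t`,
converging to pairwise distinct limits `mLim i`; at each step `bhat t` maximizes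
`m · t`; if `(N (bhat t) t / σ (bhat t))² − ∑_{i ≠ bhat t} (N i t / σ i)² < 0` the chosen
design is `I t = bhat t`, otherwise `I t` attains
`min_{i ≠ bhat t} (m (bhat t) t − m i t)² / (σ i²/N i t + σ (bhat t)²/N (bhat t) t)`; the
chosen counter is increased by `Δ`.  Then every design is sampled infinitely often, and
`bhat t` equals the index `b` of the largest limit for all sufficiently large `t`. -/
theorem stmt17
    (k : ℕ) (hk : 2 ≤ k)
    (Δ : ℕ) (hΔ : 1 ≤ Δ) (n₀ : ℕ) (hn₀ : 1 ≤ n₀)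
    (σ : Fin k → ℝ) (hσ : ∀ i, 0 < σ i)
    (m : Fin k → ℕ → ℝ) (mLim : Fin k → ℝ)
    (hm_distinct : ∀ t, Function.Injective (fun i => m i t))
    (hmLim_distinct : Function.Injective mLim)
    (hm_lim : ∀ i, Tendsto (fun t => m i t) atTop (𝓝 (mLim i)))
    (b : Fin k) (hb : ∀ i, i ≠ b → mLim i < mLim b)
    (N : Fin k → ℕ → ℕ) (I : ℕ → Fin k) (bhat : ℕ → Fin k)
    (hN0 : ∀ i, N i 0 = n₀)
    (hbhat : ∀ t i, m i t ≤ m (bhat t) t)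
    (hI1 : ∀ t,
      ((N (bhat t) t : ℝ) / σ (bhat t)) ^ 2
          - ∑ i ∈ Finset.univ.erase (bhat t), ((N i t : ℝ) / σ i) ^ 2 < 0 →
        I t = bhat t)
    (hI2 : ∀ t,
      ¬(((N (bhat t) t : ℝ) / σ (bhat t)) ^ 2
          - ∑ i ∈ Finset.univ.erase (bhat t), ((N i t : ℝ) / σ i) ^ 2 < 0) →
        I t ≠ bhat t ∧
        ∀ i ∈ Finset.univ.erase (bhat t),
          (m (bhat t) t - m (I t) t) ^ 2
              / (σ (I t) ^ 2 / (N (I t) t : ℝ) + σ (bhat t) ^ 2 / (N (bhat t) t : ℝ))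
            ≤ (m (bhat t) t - m i t) ^ 2
              / (σ i ^ 2 / (N i t : ℝ) + σ (bhat t) ^ 2 / (N (bhat t) t : ℝ)))
    (hstep : ∀ t, N (I t) (t + 1) = N (I t) t + Δ)
    (hstep' : ∀ t j, j ≠ I t → N j (t + 1) = N j t) :
    (∀ i, Tendsto (fun t => N i t) atTop atTop) ∧
    ∃ T, ∀ t, T ≤ t → bhat t = b := by
  have hmono := sampling_count_monotone hstep hstep'
  have hbest := eventually_eq_argmax_of_tendsto hm_lim hb hbhat
  refine ⟨?_, eventually_atTop.1 hbest⟩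
  have hnot := sampling_counts_not_all_bounded hΔ hmono hstep
  have hpos : ∀ i t, (0 : ℝ) < N i t := fun i t => by
    have := hmono i (Nat.zero_le t)
    rw [hN0] at this
    exact_mod_cast lt_of_lt_of_le hn₀ this
  have hbounded : ∀ i, ¬Tendsto (fun t => N i t) atTop atTop → ∃ C, ∀ t, N i t ≤ C := fun i h =>
    not_not.1 (mt (hmono i).tendsto_atTop_of_not_bounded h)
  have h_frequently : ∀ i, Tendsto (fun t => N i t) atTop atTop → ∃ᶠ t in atTop, I t = i := by
      intro i h h'
      obtain ⟨C, hC⟩ := sampling_count_bounded_of_eventually_ne hmono hstep' h'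
      obtain ⟨t, ht⟩ := (h.eventually_gt_atTop C).exists
      exact (hC t).not_gt ht
  have h_eventually_ne : ∀ i, (∃ C, ∀ t, N i t ≤ C) → ∀ᶠ t in atTop, I t ≠ i := by
    rintro i ⟨C, hC⟩
    by_contra hfreq
    have hgrow : ∀ n : ℕ, ∃ t, n ≤ N i t := fun n => by
      induction n with
      | zero => exact ⟨0, Nat.zero_le _⟩
      | succ n ih =>
        obtain ⟨t, ht⟩ := ih
        obtain ⟨s, hs, hsi⟩ := frequently_atTop.1 hfreq t
        have h₁ := hstep s
        rw [hsi] at h₁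
        have h₂ := hmono i hs
        exact ⟨s + 1, by omega⟩
    obtain ⟨t, ht⟩ := hgrow (C + 1)
    have := hC t
    omega
  -- Neglecting the best design would make the balance test bound every count.
  have hNb : Tendsto (fun t => N b t) atTop atTop := by
    by_contra h
    obtain ⟨C, hC⟩ := hbounded b h
    refine hnot fun i => ?_
    by_contra hi
    have hi' := (hmono i).tendsto_atTop_of_not_bounded hi
    have hib : i ≠ b := fun e => h (e ▸ hi')
    have hir : Tendsto (fun t => (N i t : ℝ) / σ i) atTop atTop :=
      (tendsto_natCast_atTop_atTop.comp hi').atTop_div_const (hσ i)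
    obtain ⟨t, hne, hbt, hlarge⟩ :=
      ((h_eventually_ne b ⟨C, hC⟩).and (hbest.and (hir.eventually_gt_atTop ((C : ℝ) / σ b)))).exists
    have htest := mt (hI1 t) (by rwa [hbt])
    rw [hbt] at htest
    have hsum : ((N i t : ℝ) / σ i) ^ 2 ≤
        ∑ i ∈ Finset.univ.erase b, ((N i t : ℝ) / σ i) ^ 2 :=
      Finset.single_le_sum (f := fun i => ((N i t : ℝ) / σ i) ^ 2)
        (fun _ _ => sq_nonneg _) (by simp [hib])
    have hNbC : (N b t : ℝ) / σ b ≤ C / σ b := by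
      have := hσ b
      gcongr
      exact_mod_cast hC t
    have hsq : ((N b t : ℝ) / σ b) ^ 2 < ((N i t : ℝ) / σ i) ^ 2 :=
      pow_lt_pow_left₀ (hNbC.trans_lt hlarge) (div_pos (hpos b t) (hσ b)).le two_ne_zero
    linarith
  have hNb_ratio : Tendsto (fun t => (N b t : ℝ) / σ b) atTop atTop :=
    (tendsto_natCast_atTop_atTop.comp hNb).atTop_div_const (hσ b)
  -- If all other counts stayed bounded, the test would eventually stop sampling the best design.
  obtain ⟨i, hib, hNi⟩ : ∃ i, i ≠ b ∧ Tendsto (fun t => N i t) atTop atTop := by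
    by_contra! h
    choose! C hC using fun i hi => hbounded i (h i hi)
    have hsq : Tendsto (fun t => ((N b t : ℝ) / σ b) ^ 2) atTop atTop :=
      (tendsto_pow_atTop two_ne_zero).comp hNb_ratio
    have hothers : ∀ᶠ t in atTop, ∀ i, i ≠ b → I t ≠ i := by
      refine eventually_all.2 fun i => ?_
      by_cases hi : i = b
      · exact Eventually.of_forall fun _ h => absurd hi h
      · exact (h_eventually_ne i ⟨C i, hC i hi⟩).mono fun _ h _ => h
    obtain ⟨t, hbt, hlarge, hne⟩ := (hbest.and ((hsq.eventually_ge_atTop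
      (∑ i ∈ Finset.univ.erase b, ((C i : ℝ) / σ i) ^ 2)).and hothers)).exists
    have hsum : ∑ i ∈ Finset.univ.erase b, ((N i t : ℝ) / σ i) ^ 2 ≤
        ∑ i ∈ Finset.univ.erase b, ((C i : ℝ) / σ i) ^ 2 := by
      refine Finset.sum_le_sum fun i hi => ?_
      have := hσ i
      gcongr
      exact_mod_cast hC i (Finset.ne_of_mem_erase hi) t
    have hIt := (hI2 t (by rw [hbt]; linarith)).1
    rw [hbt] at hIt
    exact hne _ hIt rfl
  intro j
  by_cases hjb : j = b
  · exact hjb ▸ hNb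
  by_contra hj
  obtain ⟨C, hC⟩ := hbounded j hj
  -- The rate of `i` diverges while that of `j` stays bounded, so `i` is eventually not sampled.
  have hinv : ∀ l, Tendsto (fun t => N l t) atTop atTop →
      Tendsto (fun t => σ l ^ 2 / (N l t : ℝ)) atTop (𝓝 0) := fun l hl =>
    tendsto_const_nhds.div_atTop (tendsto_natCast_atTop_atTop.comp hl)
  have hden : Tendsto (fun t => σ i ^ 2 / (N i t : ℝ) + σ b ^ 2 / (N b t : ℝ)) atTop
      (𝓝[>] 0) := by
    refine tendsto_nhdsWithin_iff.2 ⟨by simpa using (hinv i hNi).add (hinv b hNb), ?_⟩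
    refine Eventually.of_forall fun t => ?_
    have := hpos i t
    have := hpos b t
    have := hσ i
    have := hσ b
    exact Set.mem_Ioi.2 (by positivity)
  have hrate : Tendsto (fun t => (m b t - m i t) ^ 2
      / (σ i ^ 2 / (N i t : ℝ) + σ b ^ 2 / (N b t : ℝ))) atTop atTop := by
    have hgap : 0 < (mLim b - mLim i) ^ 2 := pow_pos (sub_pos.2 (hb i hib)) 2
    simp only [div_eq_mul_inv (((m b _ : ℝ) - m i _) ^ 2)]
    exact (((hm_lim b).sub (hm_lim i)).pow 2).pos_mul_atTop hgap
      (tendsto_inv_nhdsGT_zero.comp hden)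
  have hgap : ∀ᶠ t in atTop, (m b t - m j t) ^ 2 < (mLim b - mLim j) ^ 2 + 1 :=
    (((hm_lim b).sub (hm_lim j)).pow 2).eventually_lt_const (lt_add_one _)
  obtain ⟨t, hIt, hbt, hlarge, hsmall⟩ := ((h_frequently i hNi).and_eventually (hbest.and
    ((hrate.eventually_gt_atTop (((mLim b - mLim j) ^ 2 + 1) / (σ j ^ 2 / C))).and hgap))).exists
  have hmin := (hI2 t fun h => hib (hIt.symm.trans ((hI1 t h).trans hbt))).2 j (by simp [hbt, hjb])
  rw [hIt, hbt] at hmin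
  have hjt := hpos j t
  have hbt' := hpos b t
  have hσj := hσ j
  have hCpos : (0 : ℝ) < C := hjt.trans_le (by exact_mod_cast hC t)
  have hupper : (m b t - m j t) ^ 2 / (σ j ^ 2 / (N j t : ℝ) + σ b ^ 2 / (N b t : ℝ)) ≤
      ((mLim b - mLim j) ^ 2 + 1) / (σ j ^ 2 / C) := by
    have hle : σ j ^ 2 / (C : ℝ) ≤ σ j ^ 2 / (N j t : ℝ) := by
      gcongr
      exact_mod_cast hC t
    have hnn : 0 ≤ σ b ^ 2 / (N b t : ℝ) := by positivity
    exact div_le_div₀ (by positivity) hsmall.le (by positivity) (by linarith)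
  linarith
end

section
/- Under the OCBA-2 sampling dynamics driven by estimate sequences m_i(t) converging to pairwise distinct limits m_i, the allocation fractions α_i(t) := N_i(t)/∑_{j=1}^k N_j(t) converge as t → ∞ to a vector α** with α_i** > 0 for all i and ∑_i α_i** = 1 that satisfies (α_b**/σ_b)² = ∑_{i≠b} (α_i**/σ_i)² and (m_b − m_i)²/(σ_i²/α_i** + σ_b²/α_b**) = (m_b − m_j)²/(σ_j²/α_j** + σ_b²/α_b**) for all i, j ≠ b, where b is the index maximizing m_i. -/
open Filter Topology

/-- The optimality system for the ratios `r i = α i / α b` has a positive solution. -/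
lemma exists_optimal_ratios {ι : Type*} (s : Finset ι) (hs : s.Nonempty) (σ d : ι → ℝ) (τ : ℝ)
    (hσ : ∀ i, 0 < σ i) (hd : ∀ i ∈ s, 0 < d i) (hτ : 0 < τ) :
    ∃ (r : ι → ℝ) (v : ℝ), (∀ i ∈ s, 0 < r i) ∧ (∑ i ∈ s, (r i / σ i) ^ 2 = (1 / τ) ^ 2) ∧
      ∀ i ∈ s, d i ^ 2 / (σ i ^ 2 / r i + τ ^ 2) = v := by
  obtain ⟨j, hj, hmin⟩ := s.exists_min_image d hs
  set D : ι → ℝ → ℝ := fun i x => d i ^ 2 * ((x + τ ^ 2) / d j ^ 2) - τ ^ 2 with hD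
  have hdj := hd j hj
  have hDge : ∀ i ∈ s, ∀ x, 0 < x → x ≤ D i x := by
    intro i hi x hx
    have h1 : d j ^ 2 ≤ d i ^ 2 := by gcongr; exact hmin i hi
    have h2 : d j ^ 2 * ((x + τ ^ 2) / d j ^ 2) ≤ d i ^ 2 * ((x + τ ^ 2) / d j ^ 2) := by
      gcongr
    have h3 : d j ^ 2 * ((x + τ ^ 2) / d j ^ 2) = x + τ ^ 2 := by field_simp
    simp only [hD]; linarith
  have hDj : ∀ x, D j x = x := fun x => by simp only [hD]; field_simp; ring
  set φ : ℝ → ℝ := fun x => ∑ i ∈ s, (σ i / D i x) ^ 2 with hφ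
  set q := Real.sqrt (∑ i ∈ s, σ i ^ 2) with hq
  have hsq : q ^ 2 = ∑ i ∈ s, σ i ^ 2 := Real.sq_sqrt (Finset.sum_nonneg fun i _ => sq_nonneg _)
  have hσq : σ j ≤ q := Real.le_sqrt_of_sq_le
    (Finset.single_le_sum (f := fun i => σ i ^ 2) (fun i _ => sq_nonneg _) hj)
  have hσj := hσ j
  have hq0 : 0 < q := hσj.trans_le hσq
  have hlo : 0 < τ * σ j := by positivity
  have hle : τ * σ j ≤ τ * q := by gcongr
  have hcont : ContinuousOn φ (Set.Icc (τ * σ j) (τ * q)) := by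
    refine continuousOn_finsetSum _ fun i hi => ?_
    refine (ContinuousOn.div continuousOn_const (by fun_prop) fun x hx => ?_).pow 2
    exact (((hlo.trans_le hx.1).trans_le (hDge i hi x (hlo.trans_le hx.1)))).ne'
  have h1 : (1 / τ) ^ 2 ≤ φ (τ * σ j) := by
    have : (σ j / D j (τ * σ j)) ^ 2 ≤ φ (τ * σ j) :=
      Finset.single_le_sum (f := fun i => (σ i / D i (τ * σ j)) ^ 2) (fun i _ => sq_nonneg _) hj
    refine le_trans (le_of_eq ?_) this
    rw [hDj]; field_simp
  have h2 : φ (τ * q) ≤ (1 / τ) ^ 2 := by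
    have hx : 0 < τ * q := by positivity
    calc φ (τ * q) ≤ ∑ i ∈ s, (σ i / (τ * q)) ^ 2 := by
          refine Finset.sum_le_sum fun i hi => ?_
          have := hDge i hi _ hx
          have := hσ i
          have := hx.trans_le (hDge i hi _ hx)
          gcongr
      _ = (∑ i ∈ s, σ i ^ 2) / (τ * q) ^ 2 := by simp only [div_pow, Finset.sum_div]
      _ = (1 / τ) ^ 2 := by rw [← hsq]; field_simp
  obtain ⟨x, hx, hφx⟩ := intermediate_value_Icc' hle hcont ⟨h2, h1⟩
  have hx0 : 0 < x := hlo.trans_le hx.1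
  have hD0 : ∀ i ∈ s, 0 < D i x := fun i hi => hx0.trans_le (hDge i hi x hx0)
  refine ⟨fun i => σ i ^ 2 / D i x, d j ^ 2 / (x + τ ^ 2), fun i hi => ?_, ?_, fun i hi => ?_⟩
  · exact div_pos (pow_pos (hσ i) 2) (hD0 i hi)
  · rw [← hφx]
    refine Finset.sum_congr rfl fun i hi => ?_
    have := hσ i
    congr 1; field_simp
  · have h3 := (hD0 i hi).ne'
    have h4 := (hσ i).ne'
    have h5 : σ i ^ 2 / (σ i ^ 2 / D i x) + τ ^ 2 = d i ^ 2 * ((x + τ ^ 2) / d j ^ 2) := by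
      rw [div_div_cancel₀ (pow_ne_zero 2 h4)]; simp only [hD]; ring
    have := hd i hi
    rw [h5]; field_simp

/-- The sampling rule keeps the imbalance linear in the sample size of the best arm. -/
lemma exists_abs_imbalance_le {ι : Type*} [Fintype ι] [DecidableEq ι] (N : ι → ℕ → ℝ) (σ : ι → ℝ)
    (Δ : ℝ) (hΔ : 0 ≤ Δ) (hσ : ∀ i, 0 < σ i) (hN : ∀ i t, 0 < N i t) (I : ℕ → ι) (b : ι)
    (hstep : ∀ t, N (I t) (t + 1) = N (I t) t + Δ)
    (hstep' : ∀ t j, j ≠ I t → N j (t + 1) = N j t) (T : ℕ)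
    (hneg : ∀ t ≥ T, (N b t / σ b) ^ 2 - ∑ i ∈ Finset.univ.erase b, (N i t / σ i) ^ 2 < 0 → I t = b)
    (hnonneg : ∀ t ≥ T,
      ¬ (N b t / σ b) ^ 2 - ∑ i ∈ Finset.univ.erase b, (N i t / σ i) ^ 2 < 0 → I t ≠ b) :
    ∃ A C : ℝ, 0 ≤ C ∧ ∀ t ≥ T,
      |(N b t / σ b) ^ 2 - ∑ i ∈ Finset.univ.erase b, (N i t / σ i) ^ 2| ≤ A + C * N b t := by
  set G : ℕ → ℝ := fun t => (N b t / σ b) ^ 2 - ∑ i ∈ Finset.univ.erase b, (N i t / σ i) ^ 2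
    with hG
  set P : ℝ := ∑ i, (Δ / σ i) ^ 2 with hP
  set Q : ℝ := ∑ i, 2 * Δ / (σ i * σ b) with hQ
  have hP0 : ∀ i, (Δ / σ i) ^ 2 ≤ P := fun i =>
    Finset.single_le_sum (f := fun i => (Δ / σ i) ^ 2) (fun i _ => sq_nonneg _) (Finset.mem_univ i)
  have hQterm : ∀ i, 0 ≤ 2 * Δ / (σ i * σ b) := fun i => by
    have := hσ i; have := hσ b; positivity
  have hQ0 : ∀ i, 2 * Δ / (σ i * σ b) ≤ Q := fun i =>
    Finset.single_le_sum (f := fun i => 2 * Δ / (σ i * σ b)) (fun i _ => hQterm i)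
      (Finset.mem_univ i)
  have hQnn : 0 ≤ Q := (hQterm b).trans (hQ0 b)
  have hPnn : 0 ≤ P := (sq_nonneg _).trans (hP0 b)
  refine ⟨|G T| + P, Q, hQnn, ?_⟩
  intro t ht
  change |G t| ≤ _
  induction t, ht using Nat.le_induction with
  | base =>
    have := mul_nonneg hQnn (hN b T).le
    linarith
  | succ t ht ih =>
    have hNb := hN b t
    have hσb := hσ b
    rw [abs_le] at ih ⊢
    by_cases hneg' : G t < 0
    · have hIb := hneg t ht hneg'
      have hb1 : N b (t + 1) = N b t + Δ := by have := hstep t; rwa [hIb] at this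
      have hsum : ∑ i ∈ Finset.univ.erase b, (N i (t + 1) / σ i) ^ 2
          = ∑ i ∈ Finset.univ.erase b, (N i t / σ i) ^ 2 := by
        refine Finset.sum_congr rfl fun i hi => ?_
        rw [hstep' t i (by rw [hIb]; exact Finset.ne_of_mem_erase hi)]
      have hGs : G (t + 1) = G t + 2 * Δ / (σ b * σ b) * N b t + (Δ / σ b) ^ 2 := by
        simp only [hG, hsum, hb1]; field_simp; ring
      have e1 := mul_le_mul_of_nonneg_right (hQ0 b) hNb.le
      have e2 := mul_nonneg (hQterm b) hNb.le
      have e3 := hP0 b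
      have e4 := sq_nonneg (Δ / σ b)
      have e5 := mul_nonneg hQnn hΔ
      have e6 := abs_nonneg (G T)
      rw [hGs, hb1, mul_add]
      constructor <;> linarith
    · have hIb := hnonneg t ht hneg'
      set i := I t with hi
      have hmem : i ∈ Finset.univ.erase b := Finset.mem_erase.2 ⟨hIb, Finset.mem_univ _⟩
      have hb1 : N b (t + 1) = N b t := hstep' t b hIb.symm
      have hσi := hσ i
      have hsum : ∑ j ∈ Finset.univ.erase b, (N j (t + 1) / σ j) ^ 2
          = ∑ j ∈ Finset.univ.erase b, (N j t / σ j) ^ 2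
            + (2 * Δ / σ i * (N i t / σ i) + (Δ / σ i) ^ 2) := by
        rw [← Finset.add_sum_erase _ _ hmem,
          ← Finset.add_sum_erase _ (fun j => (N j t / σ j) ^ 2) hmem,
          Finset.sum_congr rfl fun j hj => by rw [hstep' t j (Finset.ne_of_mem_erase hj)],
          hstep t]
        field_simp; ring
      have hle : (N i t / σ i) ^ 2 ≤ (N b t / σ b) ^ 2 := by
        have := Finset.single_le_sum (f := fun j => (N j t / σ j) ^ 2)
          (fun i _ => sq_nonneg _) hmem
        simp only [hG] at hneg'
        push Not at hneg'
        linarith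
      have hle' : N i t / σ i ≤ N b t / σ b := le_of_sq_le_sq hle (by positivity)
      have hGs : G (t + 1) = G t - (2 * Δ / σ i * (N i t / σ i) + (Δ / σ i) ^ 2) := by
        simp only [hG, hsum, hb1]; ring
      have hNi := hN i t
      have e1 : 2 * Δ / σ i * (N i t / σ i) ≤ 2 * Δ / (σ i * σ b) * N b t := by
        calc 2 * Δ / σ i * (N i t / σ i) ≤ 2 * Δ / σ i * (N b t / σ b) := by gcongr
          _ = _ := by field_simp
      have e2 := mul_le_mul_of_nonneg_right (hQ0 i) hNb.le
      have e3 := hP0 i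
      have e4 : 0 ≤ 2 * Δ / σ i * (N i t / σ i) + (Δ / σ i) ^ 2 := by positivity
      have e5 := abs_nonneg (G T)
      rw [hGs, hb1]
      push Not at hneg'
      constructor <;> linarith

/-- If `x` stalls whenever the ratio `x / y` exceeds `c + ε`, with bounded increments and
`y → ∞` monotonically, then the ratio is eventually at most `c + 2 ε`. -/
lemma eventually_ratio_le (x y : ℕ → ℝ) (Δ c ε : ℝ) (hc : 0 ≤ c) (hε : 0 < ε)
    (hx : ∀ t, 0 ≤ x t) (hy : ∀ t, 0 < y t) (hmono : Monotone y) (hlim : Tendsto y atTop atTop)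
    (hinc : ∀ t, x (t + 1) ≤ x t + Δ)
    (hstall : ∀ᶠ t in atTop, c + ε ≤ x t / y t → x (t + 1) = x t) :
    ∀ᶠ t in atTop, x t / y t ≤ c + 2 * ε := by
  have hsmall : ∀ᶠ t in atTop, Δ / y t < ε :=
    (hlim.const_div_atTop Δ).eventually_lt_const hε
  obtain ⟨T, hT⟩ := eventually_atTop.1 (hstall.and hsmall)
  have hstart : ∃ t ≥ T, x t / y t ≤ c + 2 * ε := by
    by_contra! hcon
    have hconst : ∀ t ≥ T, x t = x T := by
      intro t ht
      induction t, ht using Nat.le_induction with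
      | base => rfl
      | succ t ht ih => rw [(hT t ht).1 (by linarith [hcon t ht]), ih]
    have hpos : 0 < c + 2 * ε := by positivity
    obtain ⟨t, ht1, ht2⟩ := (((hlim.const_div_atTop (x T)).eventually_lt_const hpos).and
      (eventually_ge_atTop T)).exists
    have := hcon t ht2
    rw [hconst t ht2] at this
    linarith
  obtain ⟨t₁, ht₁, h₁⟩ := hstart
  refine eventually_atTop.2 ⟨t₁, fun t ht => ?_⟩
  induction t, ht using Nat.le_induction with
  | base => exact h₁
  | succ t ht ih =>
    obtain ⟨hs, hd⟩ := hT t (ht₁.trans ht)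
    have hyy := hmono t.le_succ
    have hyt := hy t
    have hxt := hx t
    by_cases h : c + ε ≤ x t / y t
    · rw [hs h]
      exact le_trans (by gcongr) ih
    · have h1 : x (t + 1) / y (t + 1) ≤ x (t + 1) / y t := by
        have := hx (t + 1)
        gcongr
      have h2 : x (t + 1) / y t ≤ (x t + Δ) / y t := by gcongr; exact hinc t
      rw [add_div] at h2
      linarith

/-- Asymptotic upper bounds that are jointly attained by the weighted sum of squares force
convergence of every coordinate. -/
lemma tendsto_of_eventually_le_of_sum_sq {ι : Type*} (s : Finset ι) (σ r : ι → ℝ) (x : ι → ℕ → ℝ)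
    (hσ : ∀ i, 0 < σ i) (hr : ∀ i ∈ s, 0 < r i) (hx : ∀ i t, 0 ≤ x i t)
    (hsum : Tendsto (fun t => ∑ i ∈ s, (x i t / σ i) ^ 2) atTop (𝓝 (∑ i ∈ s, (r i / σ i) ^ 2)))
    (hle : ∀ i ∈ s, ∀ ε > 0, ∀ᶠ t in atTop, x i t ≤ r i + ε) :
    ∀ i ∈ s, Tendsto (x i) atTop (𝓝 (r i)) := by
  have hmax : ∀ i ∈ s, Tendsto (fun t => max (x i t) (r i)) atTop (𝓝 (r i)) := by
    intro i hi
    refine Metric.tendsto_nhds.2 fun ε hε => ?_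
    filter_upwards [hle i hi (ε / 2) (by positivity)] with t ht
    rw [Real.dist_eq, abs_of_nonneg (sub_nonneg.2 (le_max_right _ _)), sub_lt_iff_lt_add,
      max_lt_iff]
    constructor <;> linarith
  have hdiff : Tendsto (fun t => ∑ i ∈ s, ((max (x i t) (r i) / σ i) ^ 2 - (x i t / σ i) ^ 2))
      atTop (𝓝 0) := by
    have h1 : Tendsto (fun t => ∑ i ∈ s, (max (x i t) (r i) / σ i) ^ 2) atTop
        (𝓝 (∑ i ∈ s, (r i / σ i) ^ 2)) :=
      tendsto_finsetSum _ fun i hi => ((hmax i hi).div_const _).pow 2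
    simpa only [Finset.sum_sub_distrib, sub_self] using h1.sub hsum
  have hnn : ∀ i t, 0 ≤ (max (x i t) (r i) / σ i) ^ 2 - (x i t / σ i) ^ 2 := by
    intro i t
    have := hσ i
    have := hx i t
    have : x i t / σ i ≤ max (x i t) (r i) / σ i := by gcongr; exact le_max_left _ _
    rw [sub_nonneg]
    gcongr
  intro i hi
  have hi0 : Tendsto (fun t => (max (x i t) (r i) / σ i) ^ 2 - (x i t / σ i) ^ 2) atTop (𝓝 0) :=
    squeeze_zero (hnn i) (fun t => Finset.single_le_sum
      (f := fun i => (max (x i t) (r i) / σ i) ^ 2 - (x i t / σ i) ^ 2)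
      (fun i _ => hnn i t) hi) hdiff
  have hsq : Tendsto (fun t => (x i t / σ i) ^ 2) atTop (𝓝 ((r i / σ i) ^ 2)) := by
    simpa using (((hmax i hi).div_const (σ i)).pow 2).sub hi0
  have hσi := hσ i
  have hri := hr i hi
  have h := (hsq.sqrt).mul_const (σ i)
  rw [Real.sqrt_sq (by positivity), div_mul_cancel₀ _ hσi.ne'] at h
  refine h.congr fun t => ?_
  have := hx i t
  rw [Real.sqrt_sq (by positivity), div_mul_cancel₀ _ hσi.ne']

/-- OCBA-2 sampling dynamics (as in Statement 17): the allocation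
fractions `N i t / ∑ j N j t` converge to a vector `α**` which is positive, sums to `1`,
and satisfies the OCBA optimality conditions
`(α** b / σ b)² = ∑_{i ≠ b} (α** i / σ i)²` and
`(mLim b − mLim i)²/(σ i²/α** i + σ b²/α** b) = (mLim b − mLim j)²/(σ j²/α** j + σ b²/α** b)`
for all `i, j ≠ b`, where `b` is the index of the largest limit `mLim i`. -/
theorem stmt18
    (k : ℕ) (hk : 2 ≤ k)
    (Δ : ℕ) (hΔ : 1 ≤ Δ) (n₀ : ℕ) (hn₀ : 1 ≤ n₀)
    (σ : Fin k → ℝ) (hσ : ∀ i, 0 < σ i)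
    (m : Fin k → ℕ → ℝ) (mLim : Fin k → ℝ)
    (hm_distinct : ∀ t, Function.Injective (fun i => m i t))
    (hmLim_distinct : Function.Injective mLim)
    (hm_lim : ∀ i, Tendsto (fun t => m i t) atTop (𝓝 (mLim i)))
    (b : Fin k) (hb : ∀ i, i ≠ b → mLim i < mLim b)
    (N : Fin k → ℕ → ℕ) (I : ℕ → Fin k) (bhat : ℕ → Fin k)
    (hN0 : ∀ i, N i 0 = n₀)
    (hbhat : ∀ t i, m i t ≤ m (bhat t) t)
    (hI1 : ∀ t,
      ((N (bhat t) t : ℝ) / σ (bhat t)) ^ 2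
          - ∑ i ∈ Finset.univ.erase (bhat t), ((N i t : ℝ) / σ i) ^ 2 < 0 →
        I t = bhat t)
    (hI2 : ∀ t,
      ¬(((N (bhat t) t : ℝ) / σ (bhat t)) ^ 2
          - ∑ i ∈ Finset.univ.erase (bhat t), ((N i t : ℝ) / σ i) ^ 2 < 0) →
        I t ≠ bhat t ∧
        ∀ i ∈ Finset.univ.erase (bhat t),
          (m (bhat t) t - m (I t) t) ^ 2
              / (σ (I t) ^ 2 / (N (I t) t : ℝ) + σ (bhat t) ^ 2 / (N (bhat t) t : ℝ))
            ≤ (m (bhat t) t - m i t) ^ 2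
              / (σ i ^ 2 / (N i t : ℝ) + σ (bhat t) ^ 2 / (N (bhat t) t : ℝ)))
    (hstep : ∀ t, N (I t) (t + 1) = N (I t) t + Δ)
    (hstep' : ∀ t j, j ≠ I t → N j (t + 1) = N j t) :
    ∃ α : Fin k → ℝ,
      (∀ i, 0 < α i) ∧
      (∑ i, α i = 1) ∧
      ((α b / σ b) ^ 2 = ∑ i ∈ Finset.univ.erase b, (α i / σ i) ^ 2) ∧
      (∀ i ∈ Finset.univ.erase b, ∀ j ∈ Finset.univ.erase b,
        (mLim b - mLim i) ^ 2 / (σ i ^ 2 / α i + σ b ^ 2 / α b)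
          = (mLim b - mLim j) ^ 2 / (σ j ^ 2 / α j + σ b ^ 2 / α b)) ∧
      (∀ i, Tendsto (fun t => (N i t : ℝ) / ∑ j, (N j t : ℝ)) atTop (𝓝 (α i))) := by
  have hΔ' : (0 : ℝ) < Δ := by exact_mod_cast hΔ
  have hmonoN : ∀ i, Monotone (fun t => (N i t : ℝ)) := by
    refine fun i => monotone_nat_of_le_succ fun t => ?_
    by_cases h : i = I t
    · rw [h, hstep]; push_cast; linarith
    · rw [hstep' t i h]
  have hNpos : ∀ i t, (0 : ℝ) < N i t := fun i t =>
    lt_of_lt_of_le (by simp only [hN0]; exact_mod_cast hn₀) (hmonoN i (Nat.zero_le t))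
  have hbb : ∀ᶠ t in atTop, bhat t = b := by
    have : ∀ i, ∀ᶠ t in atTop, i ≠ b → m i t < m b t := by
      intro i
      by_cases h : i = b
      · simp [h]
      · filter_upwards [(hm_lim i).eventually_lt (hm_lim b) (hb i h)] with t ht _ using ht
    filter_upwards [eventually_all.2 this] with t ht
    by_contra h
    exact absurd (hbhat t b) (not_le.2 (ht _ h))
  obtain ⟨T, hT⟩ := eventually_atTop.1 hbb
  obtain ⟨A, C, hC, hAC⟩ := exists_abs_imbalance_le (fun i t => (N i t : ℝ)) σ Δ hΔ'.le hσ hNpos I b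
    (fun t => by simp [hstep t]) (fun t j hj => by simp [hstep' t j hj]) T
    (fun t ht h => by have := hI1 t; rw [hT t ht] at this; exact this h)
    (fun t ht h => by have := hI2 t; rw [hT t ht] at this; exact (this h).1)
  have hσb := hσ b
  have hNb : Tendsto (fun t => (N b t : ℝ)) atTop atTop := by
    refine (tendsto_atTop_of_monotone (hmonoN b)).resolve_right ?_
    rintro ⟨l, hl⟩
    have hlb : ∀ t, (N b t : ℝ) ≤ l := fun t => (hmonoN b).ge_of_tendsto hl t
    have htot : ∀ t : ℕ, (t : ℝ) * Δ ≤ ∑ i, (N i t : ℝ) := by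
      intro t
      induction t with
      | zero => simpa using Finset.sum_nonneg fun i _ => (hNpos i 0).le
      | succ t ih =>
        have e : ∑ i, (N i (t + 1) : ℝ) = ∑ i, (N i t : ℝ) + Δ := by
          rw [← Finset.add_sum_erase _ _ (Finset.mem_univ (I t)),
            ← Finset.add_sum_erase _ (fun i => (N i t : ℝ)) (Finset.mem_univ (I t)),
            Finset.sum_congr rfl fun j hj => by rw [hstep' t j (Finset.ne_of_mem_erase hj)],
            hstep t]
          push_cast; ring
        rw [e]; push_cast; linarith
    have hbound : ∀ t ≥ T, ∀ i, (N i t : ℝ) ≤ σ i * √((l / σ b) ^ 2 + (A + C * l)) := by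
      intro t ht i
      have hσi := hσ i
      have hCl := mul_le_mul_of_nonneg_left (hlb t) hC
      have hsq : ((N b t : ℝ) / σ b) ^ 2 ≤ (l / σ b) ^ 2 := by
        have := hlb t
        gcongr
      have habs := hAC t ht
      have habs0 := (abs_nonneg _).trans habs
      rw [← div_le_iff₀' hσi]
      refine Real.le_sqrt_of_sq_le ?_
      by_cases h : i = b
      · rw [h]; linarith
      · have := Finset.single_le_sum (f := fun j => ((N j t : ℝ) / σ j) ^ 2)
          (fun i _ => sq_nonneg _) (Finset.mem_erase.2 ⟨h, Finset.mem_univ i⟩)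
        linarith [(abs_le.1 habs).1]
    obtain ⟨t, ht1, ht2⟩ := (((tendsto_natCast_atTop_atTop (R := ℝ)).atTop_mul_const hΔ'
      |>.eventually_gt_atTop (∑ i, σ i * √((l / σ b) ^ 2 + (A + C * l)))).and
      (eventually_ge_atTop T)).exists
    linarith [htot t, Finset.sum_le_sum fun i (_ : i ∈ Finset.univ) => hbound t ht2 i]
  have hsum : Tendsto (fun t => ∑ i ∈ Finset.univ.erase b, ((N i t : ℝ) / N b t / σ i) ^ 2) atTop
      (𝓝 ((1 / σ b) ^ 2)) := by
    have h0 : Tendsto (fun t => A * ((N b t : ℝ)⁻¹ * (N b t : ℝ)⁻¹) + C * (N b t : ℝ)⁻¹) atTop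
        (𝓝 0) := by
      have := hNb.inv_tendsto_atTop
      simpa using ((this.mul this).const_mul A).add (this.const_mul C)
    have h1 : Tendsto (fun t => ∑ i ∈ Finset.univ.erase b, ((N i t : ℝ) / N b t / σ i) ^ 2
        - (1 / σ b) ^ 2) atTop (𝓝 0) := by
      refine squeeze_zero_norm' ?_ h0
      filter_upwards [eventually_ge_atTop T] with t ht
      have hpos := hNpos b t
      have e : ∑ i ∈ Finset.univ.erase b, ((N i t : ℝ) / N b t / σ i) ^ 2 - (1 / σ b) ^ 2
          = -(((N b t : ℝ) / σ b) ^ 2 - ∑ i ∈ Finset.univ.erase b, ((N i t : ℝ) / σ i) ^ 2)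
            / (N b t : ℝ) ^ 2 := by
        rw [neg_sub, sub_div, Finset.sum_div]
        congr 1
        · refine Finset.sum_congr rfl fun i _ => ?_
          have := hσ i
          field_simp
        · field_simp
      rw [e, Real.norm_eq_abs, abs_div, abs_neg, abs_of_pos (pow_pos hpos 2),
        div_le_iff₀ (by positivity)]
      refine (hAC t ht).trans (le_of_eq ?_)
      field_simp
    exact tendsto_sub_nhds_zero_iff.1 h1
  have hne : (Finset.univ.erase b).Nonempty := by
    rw [← Finset.card_pos, Finset.card_erase_of_mem (Finset.mem_univ b), Finset.card_univ,
      Fintype.card_fin]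
    omega
  obtain ⟨r, v, hr, hrsum, hrv⟩ := exists_optimal_ratios (Finset.univ.erase b) hne σ
    (fun i => mLim b - mLim i) (σ b) hσ
    (fun i hi => sub_pos.2 (hb i (Finset.ne_of_mem_erase hi))) hσb
  have hnot : ∀ i ∈ Finset.univ.erase b, ∀ ε > 0, ∀ᶠ t in atTop,
      r i + ε ≤ (N i t : ℝ) / N b t → I t ≠ i := by
    intro i hi ε hε
    have hri := hr i hi
    have hσi := hσ i
    have h1 : ∀ᶠ t in atTop, ∑ j ∈ Finset.univ.erase b, ((N j t : ℝ) / N b t / σ j) ^ 2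
        < (1 / σ b) ^ 2 + (ε / σ i) ^ 2 := hsum.eventually_lt_const (by
      have : 0 < (ε / σ i) ^ 2 := by positivity
      linarith)
    have h2 : ∀ j, ∀ᶠ t in atTop, j ∈ Finset.univ.erase b →
        (m b t - m j t) ^ 2 / (σ j ^ 2 / r j + σ b ^ 2)
          < (m b t - m i t) ^ 2 / (σ i ^ 2 / (r i + ε) + σ b ^ 2) := by
      intro j
      by_cases hj : j ∈ Finset.univ.erase b
      · have hlt : (mLim b - mLim j) ^ 2 / (σ j ^ 2 / r j + σ b ^ 2)
            < (mLim b - mLim i) ^ 2 / (σ i ^ 2 / (r i + ε) + σ b ^ 2) := by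
          rw [hrv j hj, ← hrv i hi]
          have : 0 < mLim b - mLim i := sub_pos.2 (hb i (Finset.ne_of_mem_erase hi))
          gcongr
          linarith
        filter_upwards [((((hm_lim b).sub (hm_lim j)).pow 2).div_const _).eventually_lt
          ((((hm_lim b).sub (hm_lim i)).pow 2).div_const _) hlt] with t ht _ using ht
      · simp [hj]
    filter_upwards [h1, eventually_all.2 h2, hbb] with t h1 h2 hbt hge hIt
    obtain ⟨j, hj, hjr⟩ : ∃ j ∈ Finset.univ.erase b, (N j t : ℝ) / N b t < r j := by
      by_contra! hcon
      refine absurd h1 (not_lt.2 ?_)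
      have hkey : ∀ j ∈ Finset.univ.erase b, (r j / σ j) ^ 2 ≤ ((N j t : ℝ) / N b t / σ j) ^ 2 := by
        intro j hj
        have := hcon j hj
        have := hr j hj
        have := hσ j
        gcongr
      have hi' : (r i / σ i) ^ 2 + (ε / σ i) ^ 2 ≤ ((N i t : ℝ) / N b t / σ i) ^ 2 := by
        calc (r i / σ i) ^ 2 + (ε / σ i) ^ 2 ≤ ((r i + ε) / σ i) ^ 2 := by
              have : 0 ≤ 2 * (r i / σ i) * (ε / σ i) := by positivity
              rw [add_div]; nlinarith
          _ ≤ _ := by gcongr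
      rw [← hrsum, ← Finset.add_sum_erase _ _ hi,
        ← Finset.add_sum_erase _ (fun j => ((N j t : ℝ) / N b t / σ j) ^ 2) hi]
      linarith [Finset.sum_le_sum fun j (hj : j ∈ (Finset.univ.erase b).erase i) =>
        hkey j (Finset.mem_of_mem_erase hj)]
    have hIne : I t ≠ b := by rw [hIt]; exact Finset.ne_of_mem_erase hi
    have hmin := hI2 t
    have hfirst := hI1 t
    rw [hbt] at hmin hfirst
    have hle := (hmin fun h => hIne (hfirst h)).2 j hj
    rw [hIt] at hle
    have hrj := hr j hj
    have hb0 := hNpos b t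
    have hi0 := hNpos i t
    have hj0 := hNpos j t
    have hσj := hσ j
    have hscale : ∀ l, (m b t - m l t) ^ 2 / (σ l ^ 2 / (N l t : ℝ) + σ b ^ 2 / (N b t : ℝ))
        = N b t * ((m b t - m l t) ^ 2 / (σ l ^ 2 / ((N l t : ℝ) / N b t) + σ b ^ 2)) := by
      intro l
      have := hNpos l t
      have := hσ l
      field_simp
    rw [hscale, hscale, mul_le_mul_iff_right₀ hb0] at hle
    have e1 : (m b t - m i t) ^ 2 / (σ i ^ 2 / (r i + ε) + σ b ^ 2)
        ≤ (m b t - m i t) ^ 2 / (σ i ^ 2 / ((N i t : ℝ) / N b t) + σ b ^ 2) := by gcongr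
    have e2 : (m b t - m j t) ^ 2 / (σ j ^ 2 / ((N j t : ℝ) / N b t) + σ b ^ 2)
        ≤ (m b t - m j t) ^ 2 / (σ j ^ 2 / r j + σ b ^ 2) := by gcongr
    linarith [h2 j hj]
  have hinc : ∀ i t, (N i (t + 1) : ℝ) ≤ N i t + Δ := by
    intro i t
    by_cases h : i = I t
    · rw [h, hstep]; push_cast; rfl
    · rw [hstep' t i h]; linarith
  have hlim : ∀ i ∈ Finset.univ.erase b,
      Tendsto (fun t => (N i t : ℝ) / N b t) atTop (𝓝 (r i)) := by
    refine tendsto_of_eventually_le_of_sum_sq (Finset.univ.erase b) σ r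
      (fun i t => (N i t : ℝ) / N b t) hσ hr (fun i t => by positivity) (by rwa [hrsum]) ?_
    intro i hi ε hε
    have := eventually_ratio_le (fun t => (N i t : ℝ)) (fun t => (N b t : ℝ)) Δ (r i) (ε / 2)
      (hr i hi).le (by positivity) (fun t => (hNpos i t).le) (hNpos b) (hmonoN b) hNb (hinc i) (by
        filter_upwards [hnot i hi (ε / 2) (by positivity)] with t ht h
        rw [hstep' t i (ht h).symm])
    filter_upwards [this] with t ht
    linarith
  set ρ : Fin k → ℝ := fun i => if i = b then 1 else r i with hρ
  have hρb : ρ b = 1 := by simp [hρ]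
  have hρi : ∀ i ∈ Finset.univ.erase b, ρ i = r i := fun i hi => by
    simp [hρ, Finset.ne_of_mem_erase hi]
  have hρpos : ∀ i, 0 < ρ i := by
    intro i
    by_cases h : i = b
    · rw [h, hρb]; exact one_pos
    · have hi : i ∈ Finset.univ.erase b := Finset.mem_erase.2 ⟨h, Finset.mem_univ _⟩
      rw [hρi i hi]; exact hr i hi
  have hρlim : ∀ i, Tendsto (fun t => (N i t : ℝ) / N b t) atTop (𝓝 (ρ i)) := by
    intro i
    by_cases h : i = b
    · rw [h, hρb]
      exact tendsto_const_nhds.congr fun t => (div_self (hNpos b t).ne').symm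
    · have hi : i ∈ Finset.univ.erase b := Finset.mem_erase.2 ⟨h, Finset.mem_univ _⟩
      rw [hρi i hi]; exact hlim i hi
  set S := ∑ i, ρ i with hS
  have hS0 : 0 < S := Finset.sum_pos (fun i _ => hρpos i) ⟨b, Finset.mem_univ b⟩
  refine ⟨fun i => ρ i / S, fun i => div_pos (hρpos i) hS0, ?_, ?_, ?_, ?_⟩
  · rw [← Finset.sum_div, div_self hS0.ne']
  · have e : ∑ i ∈ Finset.univ.erase b, (ρ i / S / σ i) ^ 2
        = (∑ i ∈ Finset.univ.erase b, (r i / σ i) ^ 2) / S ^ 2 := by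
      rw [Finset.sum_div]
      refine Finset.sum_congr rfl fun i hi => ?_
      rw [hρi i hi]
      have := hσ i
      field_simp
    simp only [e, hrsum, hρb]
    field_simp
  · have e : ∀ i ∈ Finset.univ.erase b,
        (mLim b - mLim i) ^ 2 / (σ i ^ 2 / (ρ i / S) + σ b ^ 2 / (ρ b / S)) = v / S := by
      intro i hi
      rw [← hrv i hi, hρi i hi, hρb]
      have := hr i hi
      have := hσ i
      field_simp
    intro i hi j hj
    simp only [e i hi, e j hj]
  · intro i
    refine ((hρlim i).div (tendsto_finsetSum _ fun j _ => hρlim j) hS0.ne').congr fun t => ?_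
    rw [Pi.div_apply, ← Finset.sum_div, div_div_div_cancel_right₀ (hNpos b t).ne']
end
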